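/- arXiv:2409.07317 — 2 statements merged into one kernel-verified Lean document; each statement's English description precedes it below -/
import Mathlib

section
/- (Structure of the twisted affine Weyl group, not of type BC_l^{(2)}.) Let R_f have two root lengths with highest short root θ_s and t = I_f(θ,θ)/I_f(θ_s,θ_s) ∈ {2,3}. Let Ŵ be the subgroup of O(F̂, Î) generated by the reflections ŝ_{α + nδ} for α ∈ (R_f)_s, n ∈ ℤ, together with ŝ_{α + tnδ} for α ∈ (R_f)_l, n ∈ ℤ. Then Ŵ = { u ∘ t_γ : u ∈ W(R_f), γ ∈ (2/I_f(θ_s,θ_s))·Q(R_f) } and the map (u, γ) ↦ u ∘ t_γ is a group isomorphism from W(R_f) ⋉ (2/I_f(θ_s,θ_s))Q(R_f) onto Ŵ. -/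
open scoped BigOperators Classical

/-- A reduced irreducible finite root system spanning a real vector space `V`,
equipped with a positive definite symmetric bilinear form `I`. -/
structure RootSys (V : Type) [AddCommGroup V] [Module ℝ V] where
  I : V →ₗ[ℝ] V →ₗ[ℝ] ℝ
  symm : ∀ x y : V, I x y = I y x
  posdef : ∀ x : V, x ≠ 0 → 0 < I x x
  R : Finset V
  zero_notmem : (0 : V) ∉ R
  spanning : Submodule.span ℝ (R : Set V) = ⊤
  reduced : ∀ α ∈ R, ∀ c : ℝ, c • α ∈ R → c = 1 ∨ c = -1
  integral : ∀ α ∈ R, ∀ β ∈ R, ∃ n : ℤ, I ((2 / I α α) • α) β = (n : ℝ)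
  reflect : ∀ α ∈ R, ∀ β ∈ R, β - (I ((2 / I α α) • α) β) • α ∈ R
  irred : ∀ R₁ R₂ : Finset V, R₁ ∪ R₂ = R →
    (∀ α ∈ R₁, ∀ β ∈ R₂, I α β = 0) → R₁ = ∅ ∨ R₂ = ∅

/-- The Weyl group of `R_f`: the subgroup of linear automorphisms generated by the
reflections `s_α(λ) = λ − I(λ,α^∨)α`, `α ∈ R_f`. -/
noncomputable def Weyl {V : Type} [AddCommGroup V] [Module ℝ V] (S : RootSys V) :
    Subgroup (V ≃ₗ[ℝ] V) :=
  Subgroup.closure {u | ∃ α ∈ S.R, ∀ x : V, u x = x - (2 * S.I α x / S.I α α) • α}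

/-- The extended space `F̂ = F_f ⊕ ℝδ ⊕ ℝΛ₀`. -/
abbrev HatV (V : Type) := V × ℝ × ℝ

/-- The null vector `δ`. -/
def deltaH {V : Type} [AddCommGroup V] : HatV V := (0, 1, 0)

/-- The null vector `Λ₀`. -/
def lamH {V : Type} [AddCommGroup V] : HatV V := (0, 0, 1)

/-- The embedding `F_f → F̂`. -/
def embH {V : Type} [AddCommGroup V] (x : V) : HatV V := (x, 0, 0)

/-- The symmetric bilinear form `Î` on `F̂` extending `I`, with
`Î(δ, F_f) = Î(Λ₀, F_f) = 0`, `Î(δ,δ) = Î(Λ₀,Λ₀) = 0`, `Î(δ,Λ₀) = 1`. -/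
noncomputable def hatI {V : Type} [AddCommGroup V] [Module ℝ V]
    (I : V →ₗ[ℝ] V →ₗ[ℝ] ℝ) (p q : HatV V) : ℝ :=
  I p.1 q.1 + p.2.1 * q.2.2 + p.2.2 * q.2.1

/-- The translation `t_γ(λ) = λ + Î(λ,δ)γ − (Î(λ,γ) + (1/2)Î(γ,γ)Î(λ,δ))δ` for `γ ∈ F_f`. -/
noncomputable def tH {V : Type} [AddCommGroup V] [Module ℝ V]
    (I : V →ₗ[ℝ] V →ₗ[ℝ] ℝ) (γ : V) (p : HatV V) : HatV V :=
  p + (hatI I p deltaH) • embH γ -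
    (hatI I p (embH γ) + (1 / 2) * hatI I (embH γ) (embH γ) * hatI I p deltaH) • deltaH

/-- The extension of `u : F_f → F_f` to `F̂`, acting as `u` on `F_f` and fixing `δ` and `Λ₀`. -/
def uHat {V : Type} [AddCommGroup V] [Module ℝ V] (u : V ≃ₗ[ℝ] V) (p : HatV V) : HatV V :=
  (u p.1, p.2.1, p.2.2)

/-- The reflection `ŝ_v(λ) = λ − Î(λ, v^∨)v` on `F̂`, where `v^∨ = 2v/Î(v,v)`. -/
noncomputable def sH {V : Type} [AddCommGroup V] [Module ℝ V]
    (I : V →ₗ[ℝ] V →ₗ[ℝ] ℝ) (v : HatV V) (p : HatV V) : HatV V :=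
  p - (hatI I p ((2 / hatI I v v) • v)) • v

/-- The root lattice `Q(R)`, generated by the roots. -/
noncomputable def rootLat {V : Type} [AddCommGroup V] [Module ℝ V] (S : RootSys V) :
    AddSubgroup V := AddSubgroup.closure (S.R : Set V)

namespace RootSys

variable {V : Type} [AddCommGroup V] [Module ℝ V]

/-- The extension `u ↦ uHat u` as a group homomorphism. -/
def uHatHom : (V ≃ₗ[ℝ] V) →* (HatV V ≃ₗ[ℝ] HatV V) where
  toFun u := u.prodCongr (LinearEquiv.refl ℝ (ℝ × ℝ))
  map_one' := rfl
  map_mul' _ _ := rfl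

lemma tH_apply (I : V →ₗ[ℝ] V →ₗ[ℝ] ℝ) (γ : V) (p : HatV V) :
    tH I γ p =
      (p.1 + p.2.2 • γ, p.2.1 - (I p.1 γ + 1 / 2 * I γ γ * p.2.2), p.2.2) := by
  simp [tH, hatI, embH, deltaH, Prod.ext_iff]

lemma tH_zero (I : V →ₗ[ℝ] V →ₗ[ℝ] ℝ) (p : HatV V) : tH I 0 p = p := by
  simp [tH_apply]

lemma tH_tH (S : RootSys V) (γ₁ γ₂ : V) (p : HatV V) :
    tH S.I γ₁ (tH S.I γ₂ p) = tH S.I (γ₁ + γ₂) p := by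
  simp only [tH_apply, Prod.ext_iff, map_add, map_smul, LinearMap.add_apply,
    LinearMap.smul_apply, smul_eq_mul, smul_add, S.symm γ₂ γ₁]
  refine ⟨by abel, by ring, trivial⟩

/-- The translation `t_γ` as a linear automorphism of `F̂`. -/
noncomputable def tEquiv (S : RootSys V) (γ : V) : HatV V ≃ₗ[ℝ] HatV V where
  toFun := tH S.I γ
  map_add' p q := by
    simp only [tH_apply, Prod.ext_iff, Prod.fst_add, Prod.snd_add, map_add,
      LinearMap.add_apply, add_smul]
    refine ⟨by abel, by ring, trivial⟩
  map_smul' c p := by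
    simp only [tH_apply, Prod.ext_iff, Prod.smul_fst, Prod.smul_snd, map_smul,
      LinearMap.smul_apply, smul_eq_mul, RingHom.id_apply, smul_add, mul_smul]
    refine ⟨trivial, by ring, trivial⟩
  invFun := tH S.I (-γ)
  left_inv p := by rw [tH_tH, neg_add_cancel, tH_zero]
  right_inv p := by rw [tH_tH, add_neg_cancel, tH_zero]

lemma tEquiv_zero (S : RootSys V) : S.tEquiv 0 = 1 :=
  LinearEquiv.ext fun p => tH_zero S.I p

lemma tEquiv_add (S : RootSys V) (γ₁ γ₂ : V) :
    S.tEquiv (γ₁ + γ₂) = S.tEquiv γ₁ * S.tEquiv γ₂ :=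
  LinearEquiv.ext fun p => (S.tH_tH γ₁ γ₂ p).symm

lemma tEquiv_neg (S : RootSys V) (γ : V) : S.tEquiv (-γ) = (S.tEquiv γ)⁻¹ := by
  rw [eq_inv_iff_mul_eq_one, ← tEquiv_add, neg_add_cancel, tEquiv_zero]

lemma ne_zero_of_mem (S : RootSys V) {α : V} (hα : α ∈ S.R) : α ≠ 0 :=
  fun h => S.zero_notmem (h ▸ hα)

lemma I_self_pos (S : RootSys V) {α : V} (hα : α ∈ S.R) : 0 < S.I α α :=
  S.posdef α (S.ne_zero_of_mem hα)

lemma exists_reflection (S : RootSys V) {α : V} (hα : α ∈ S.R) :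
    ∃ u ∈ Weyl S, ∀ x : V, u x = x - (2 * S.I α x / S.I α α) • α := by
  have h : ((2 / S.I α α) • S.I α) α = 2 := by
    have := (S.I_self_pos hα).ne'
    simp [this]
  have hu (x : V) : Module.reflection h x = x - (2 * S.I α x / S.I α α) • α := by
    rw [Module.reflection_apply, LinearMap.smul_apply, smul_eq_mul, div_mul_eq_mul_div]
  exact ⟨_, Subgroup.subset_closure ⟨α, hα, hu⟩, hu⟩

lemma Weyl_preserves_I (S : RootSys V) {u : V ≃ₗ[ℝ] V} (hu : u ∈ Weyl S) :
    ∀ x y, S.I (u x) (u y) = S.I x y := by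
  induction hu using Subgroup.closure_induction with
  | mem u h =>
    obtain ⟨α, hα, h⟩ := h
    intro x y
    have := (S.I_self_pos hα).ne'
    simp only [h, map_sub, map_smul, LinearMap.sub_apply, LinearMap.smul_apply, smul_eq_mul,
      S.symm x α]
    field_simp
    ring
  | one => exact fun _ _ => rfl
  | mul u v _ _ hu hv => exact fun x y => (hu _ _).trans (hv x y)
  | inv u _ hu =>
    intro x y
    rw [← hu]
    exact congrArg₂ (fun a b => S.I a b) (u.apply_symm_apply x) (u.apply_symm_apply y)

lemma Weyl_apply_mem_rootLat_iff (S : RootSys V) {u : V ≃ₗ[ℝ] V} (hu : u ∈ Weyl S) :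
    ∀ y, u y ∈ rootLat S ↔ y ∈ rootLat S := by
  induction hu using Subgroup.closure_induction with
  | mem u h =>
    obtain ⟨α, hα, h⟩ := h
    have maps (y : V) (hy : y ∈ rootLat S) : u y ∈ rootLat S := by
      have hle : rootLat S ≤ (rootLat S).comap (u : V →+ V) := by
        refine (AddSubgroup.closure_le _).2 fun β hβ => AddSubgroup.subset_closure ?_
        have := S.reflect α hα β hβ
        rw [map_smul, LinearMap.smul_apply, smul_eq_mul, div_mul_eq_mul_div, ← h] at this
        exact this
      exact hle hy
    have invol (y : V) : u (u y) = y := by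
      have := (S.I_self_pos hα).ne'
      rw [h (u y), h y, sub_sub, ← add_smul, sub_eq_self]
      convert zero_smul ℝ α
      simp only [map_sub, map_smul, smul_eq_mul]
      field_simp
      ring
    exact fun y => ⟨fun hy => invol y ▸ maps _ hy, maps y⟩
  | one => exact fun _ => Iff.rfl
  | mul u v _ _ hu hv => exact fun y => (hu _).trans (hv y)
  | inv u _ hu =>
    intro y
    rw [← hu]
    exact iff_of_eq (congrArg (· ∈ rootLat S) (u.apply_symm_apply y))

lemma tH_uHat (S : RootSys V) {u : V ≃ₗ[ℝ] V} (hu : u ∈ Weyl S) (γ : V) (p : HatV V) :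
    tH S.I γ (uHat u p) = uHat u (tH S.I (u⁻¹ γ) p) := by
  have hγ : u (u⁻¹ γ) = γ := u.apply_symm_apply γ
  have hI := S.Weyl_preserves_I hu
  simp only [tH_apply, uHat, map_add, map_smul, hγ, ← hI p.1 (u⁻¹ γ), ← hI (u⁻¹ γ) (u⁻¹ γ)]

lemma uHat_tH_comp (S : RootSys V) (u₁ : V ≃ₗ[ℝ] V) {u₂ : V ≃ₗ[ℝ] V} (hu₂ : u₂ ∈ Weyl S)
    (γ₁ γ₂ : V) :
    (uHat u₁ ∘ tH S.I γ₁) ∘ (uHat u₂ ∘ tH S.I γ₂) =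
      uHat (u₁ * u₂) ∘ tH S.I (u₂⁻¹ γ₁ + γ₂) := by
  funext p
  simp only [Function.comp_apply, S.tH_uHat hu₂, tH_tH]
  rfl

lemma tEquiv_mul_uHatHom (S : RootSys V) {u : V ≃ₗ[ℝ] V} (hu : u ∈ Weyl S) (γ : V) :
    S.tEquiv γ * uHatHom u = uHatHom u * S.tEquiv (u⁻¹ γ) :=
  LinearEquiv.ext fun p => S.tH_uHat hu γ p

lemma uHat_tH_injective (S : RootSys V) {u₁ u₂ : V ≃ₗ[ℝ] V} {γ₁ γ₂ : V}
    (h : ∀ p : HatV V, uHat u₁ (tH S.I γ₁ p) = uHat u₂ (tH S.I γ₂ p)) :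
    u₁ = u₂ ∧ γ₁ = γ₂ := by
  have hu : u₁ = u₂ := LinearEquiv.ext fun x => by
    simpa [tH_apply, uHat, embH] using congrArg Prod.fst (h (embH x))
  subst hu
  refine ⟨rfl, ?_⟩
  simpa [tH_apply, uHat, lamH] using congrArg Prod.fst (h lamH)

/-- The affine reflection in `α + mδ` is the composite `s_α ∘ t_{m α^∨}`. -/
lemma sH_eq_uHat_tH (S : RootSys V) {α : V} (hα : α ∈ S.R) {u : V ≃ₗ[ℝ] V}
    (hu : ∀ x : V, u x = x - (2 * S.I α x / S.I α α) • α) (m : ℝ) (p : HatV V) :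
    sH S.I (embH α + m • deltaH) p = uHat u (tH S.I ((m * (2 / S.I α α)) • α) p) := by
  have := (S.I_self_pos hα).ne'
  simp only [sH, hatI, embH, deltaH, tH_apply, uHat, hu, Prod.ext_iff, Prod.fst_sub,
    Prod.snd_sub, Prod.smul_fst, Prod.smul_snd, Prod.fst_add, Prod.snd_add, map_add, map_smul,
    LinearMap.smul_apply, smul_eq_mul, S.symm p.1 α, smul_zero, mul_zero, zero_mul, mul_one,
    zero_add, add_zero, sub_zero]
  refine ⟨?_, ?_, trivial⟩
  · match_scalars
    · ring
    · field_simp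
      ring
  · field_simp

/-- The sublattice `k • Q(R)`, as an additive subgroup. -/
noncomputable def scaledLat (S : RootSys V) (k : ℝ) : AddSubgroup V :=
  (rootLat S).map (DistribSMul.toAddMonoidHom V k)

lemma mem_scaledLat (S : RootSys V) {k : ℝ} {γ : V} :
    γ ∈ S.scaledLat k ↔ ∃ y ∈ rootLat S, γ = k • y := by
  simp [scaledLat, eq_comm]

lemma Weyl_apply_mem_scaledLat (S : RootSys V) {k : ℝ} {u : V ≃ₗ[ℝ] V} (hu : u ∈ Weyl S)
    {γ : V} (hγ : γ ∈ S.scaledLat k) : u γ ∈ S.scaledLat k := by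
  obtain ⟨y, hy, rfl⟩ := S.mem_scaledLat.1 hγ
  exact S.mem_scaledLat.2 ⟨u y, (S.Weyl_apply_mem_rootLat_iff hu y).2 hy, map_smul u k y⟩

/-- A group generated by affine reflections `s_α ∘ t_{n k α}`, `α ∈ R`, `n ∈ ℤ`, is
`W(R) ⋉ k Q(R)`. -/
lemma mem_closure_iff (S : RootSys V) (k : ℝ) (G : Set (HatV V ≃ₗ[ℝ] HatV V))
    (hG : ∀ e ∈ G, ∃ α ∈ S.R, ∃ n : ℤ, ∃ u ∈ Weyl S,
      e = uHatHom u * S.tEquiv ((n : ℝ) • k • α))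
    (hG' : ∀ α ∈ S.R, ∀ n : ℤ, ∀ u : V ≃ₗ[ℝ] V,
      (∀ x : V, u x = x - (2 * S.I α x / S.I α α) • α) →
        uHatHom u * S.tEquiv ((n : ℝ) • k • α) ∈ G)
    (e : HatV V ≃ₗ[ℝ] HatV V) :
    e ∈ Subgroup.closure G ↔
      ∃ u ∈ Weyl S, ∃ γ ∈ S.scaledLat k, e = uHatHom u * S.tEquiv γ := by
  constructor
  · intro he
    induction he using Subgroup.closure_induction with
    | mem e he =>
      obtain ⟨α, hα, n, u, hu, rfl⟩ := hG e he
      refine ⟨u, hu, _, ?_, rfl⟩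
      rw [Int.cast_smul_eq_zsmul]
      exact zsmul_mem (S.mem_scaledLat.2 ⟨α, AddSubgroup.subset_closure hα, rfl⟩) n
    | one => exact ⟨1, one_mem _, 0, zero_mem _, by rw [tEquiv_zero, map_one, one_mul]⟩
    | mul e f _ _ he hf =>
      obtain ⟨u, hu, γ, hγ, rfl⟩ := he
      obtain ⟨v, hv, γ', hγ', rfl⟩ := hf
      refine ⟨u * v, mul_mem hu hv, v⁻¹ γ + γ',
        add_mem (S.Weyl_apply_mem_scaledLat (inv_mem hv) hγ) hγ', ?_⟩
      rw [mul_assoc, ← mul_assoc (S.tEquiv γ), S.tEquiv_mul_uHatHom hv, map_mul, tEquiv_add]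
      simp only [mul_assoc]
    | inv e _ he =>
      obtain ⟨u, hu, γ, hγ, rfl⟩ := he
      refine ⟨u⁻¹, inv_mem hu, u (-γ), S.Weyl_apply_mem_scaledLat hu (neg_mem hγ), ?_⟩
      rw [mul_inv_rev, ← tEquiv_neg, ← map_inv, S.tEquiv_mul_uHatHom (inv_mem hu), inv_inv]
  · rintro ⟨u, hu, γ, hγ, rfl⟩
    have hW : Weyl S ≤ (Subgroup.closure G).comap uHatHom := by
      refine (Subgroup.closure_le _).2 ?_
      rintro u ⟨α, hα, hu⟩
      refine Subgroup.subset_closure ?_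
      simpa [tEquiv_zero] using hG' α hα 0 u hu
    refine mul_mem (hW hu) ?_
    obtain ⟨y, hy, rfl⟩ := S.mem_scaledLat.1 hγ
    clear hγ
    induction hy using AddSubgroup.closure_induction with
    | mem α hα =>
      obtain ⟨v, hv, hv'⟩ := S.exists_reflection hα
      have hmem : uHatHom v * S.tEquiv (k • α) ∈ Subgroup.closure G := by
        simpa using Subgroup.subset_closure (hG' α hα 1 v hv')
      exact ((Subgroup.closure G).mul_mem_cancel_left (hW hv)).1 hmem
    | zero => rw [smul_zero, tEquiv_zero]; exact one_mem _
    | add x y _ _ hx hy => rw [smul_add, tEquiv_add]; exact mul_mem hx hy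
    | neg x _ hx => rw [smul_neg, tEquiv_neg]; exact inv_mem hx

end RootSys

/-- **Structure of the twisted affine Weyl group, not of type `BC_l^{(2)}`:**
`Ŵ = { u ∘ t_γ : u ∈ W(R_f), γ ∈ (2/I(θ_s,θ_s))·Q(R_f) }`, and `(u,γ) ↦ u ∘ t_γ` is a
group isomorphism from `W(R_f) ⋉ (2/I(θ_s,θ_s))Q(R_f)` onto `Ŵ`. -/
theorem affine_weyl_structure_twisted (V : Type) [AddCommGroup V] [Module ℝ V]
    [FiniteDimensional ℝ V] (S : RootSys V)
    -- θ is the highest root, θs the highest short root; R_f has two root lengths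
    (θ : V) (hθR : θ ∈ S.R) (θs : V) (hθsR : θs ∈ S.R)
    (htwo : ∀ α ∈ S.R, S.I α α = S.I θs θs ∨ S.I α α = S.I θ θ)
    (hne : S.I θs θs ≠ S.I θ θ)
    -- the tier number t = I(θ,θ)/I(θs,θs) ∈ {2,3}
    (t : ℝ) (htdef : t = S.I θ θ / S.I θs θs) (ht : t = 2 ∨ t = 3) :
    -- Ŵ: generated by ŝ_{α+nδ} for α short and ŝ_{α+tnδ} for α long
    let What : Subgroup (HatV V ≃ₗ[ℝ] HatV V) := Subgroup.closure
      {e | (∃ α ∈ S.R, S.I α α = S.I θs θs ∧ ∃ n : ℤ,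
              ∀ p : HatV V, e p = sH S.I (embH α + (n : ℝ) • deltaH) p) ∨
           (∃ α ∈ S.R, S.I α α = S.I θ θ ∧ ∃ n : ℤ,
              ∀ p : HatV V, e p = sH S.I (embH α + (t * (n : ℝ)) • deltaH) p)}
    -- Ŵ is exactly the set of elements u ∘ t_γ, γ ∈ (2/I(θs,θs))·Q(R_f)
    (∀ e : HatV V ≃ₗ[ℝ] HatV V, e ∈ What ↔
      ∃ u ∈ Weyl S, ∃ γ : V, (∃ y ∈ rootLat S, γ = (2 / S.I θs θs) • y) ∧
        ∀ p : HatV V, e p = uHat u (tH S.I γ p)) ∧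
    -- the map (u, γ) ↦ u ∘ t_γ is injective
    (∀ u₁ ∈ Weyl S, ∀ u₂ ∈ Weyl S, ∀ γ₁ γ₂ : V,
      (∃ y ∈ rootLat S, γ₁ = (2 / S.I θs θs) • y) →
      (∃ y ∈ rootLat S, γ₂ = (2 / S.I θs θs) • y) →
      (∀ p : HatV V, uHat u₁ (tH S.I γ₁ p) = uHat u₂ (tH S.I γ₂ p)) →
        u₁ = u₂ ∧ γ₁ = γ₂) ∧
    -- and it is a homomorphism from the semidirect product
    (∀ u₁ ∈ Weyl S, ∀ u₂ ∈ Weyl S, ∀ γ₁ γ₂ : V,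
      (uHat u₁ ∘ tH S.I γ₁) ∘ (uHat u₂ ∘ tH S.I γ₂) =
        uHat (u₁ * u₂) ∘ tH S.I (u₂⁻¹ γ₁ + γ₂)) := by
  intro What
  have hs := (S.I_self_pos hθsR).ne'
  have hl := (S.I_self_pos hθR).ne'
  have hcoef (n : ℤ) (α : V) :
      (t * (n : ℝ) * (2 / S.I θ θ)) • α = (n : ℝ) • (2 / S.I θs θs) • α := by
    rw [smul_smul, htdef]
    congr 1
    field_simp
  refine ⟨fun e => ?_, fun u₁ _ u₂ _ γ₁ γ₂ _ _ h => S.uHat_tH_injective h,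
    fun u₁ _ u₂ hu₂ γ₁ γ₂ => S.uHat_tH_comp u₁ hu₂ γ₁ γ₂⟩
  refine (S.mem_closure_iff (2 / S.I θs θs) _ ?_ ?_ e).trans ?_
  · rintro e (⟨α, hα, hlen, n, he⟩ | ⟨α, hα, hlen, n, he⟩)
    all_goals
      obtain ⟨u, hu, hu'⟩ := S.exists_reflection hα
      refine ⟨α, hα, n, u, hu, LinearEquiv.ext fun p => ?_⟩
      rw [he, S.sH_eq_uHat_tH hα hu', hlen]
    · rw [mul_smul]; rfl
    · rw [hcoef]; rfl
  · intro α hα n u hu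
    rcases htwo α hα with hlen | hlen
    · refine Or.inl ⟨α, hα, hlen, n, fun p => ?_⟩
      rw [S.sH_eq_uHat_tH hα hu, hlen, mul_smul]
      rfl
    · refine Or.inr ⟨α, hα, hlen, n, fun p => ?_⟩
      rw [S.sH_eq_uHat_tH hα hu, hlen, hcoef]
      rfl
  · simp only [RootSys.mem_scaledLat, LinearEquiv.ext_iff]
    rfl
end

section
/- (Intermediate identity (7), untwisted case.) Let R_af = R_f + ℤδ with simple roots α_0 = δ − θ, α_1, …, α_l, set h^∨ = 1 + I_f(ρ_f, θ^∨), c = (I_f(θ,θ)/2)·h^∨, and ρ = ρ_f + c·Λ_0. Then the following identity holds in the algebra ℰ: e^{−(I_f(ρ_f,ρ_f)/(2c))δ} · ∏_{n=1}^∞ ( (1 − e^{−nδ})^l · ∏_{α ∈ R_f} (1 − e^{−α − nδ}) ) = Σ_{γ ∈ c·Q(R_f^∨)} A_γ · e^{−(I_f(ρ_f + γ, ρ_f + γ)/(2c))δ}, where for each γ, A_γ is the unique element of ℰ satisfying A_γ · ( e^{ρ_f} ∏_{α ∈ R_f^+} (1 − e^{−α}) ) = Σ_{u ∈ W(R_f)}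 det(u) e^{u(ρ_f + γ)}. -/
open scoped BigOperators Classical

/-- A choice of positive roots and simple roots for a finite root system. -/
structure Base {V : Type} [AddCommGroup V] [Module ℝ V] (S : RootSys V) where
  Pos : Finset V
  Pi : Finset V
  pos_sub : Pos ⊆ S.R
  mem_or_neg : ∀ α ∈ S.R, α ∈ Pos ∨ -α ∈ Pos
  not_both : ∀ α ∈ Pos, -α ∉ Pos
  pi_sub : Pi ⊆ Pos
  indep : LinearIndependent ℝ (fun b : {x // x ∈ Pi} => (b : V))
  decomp : ∀ α ∈ Pos, ∃ c : V → ℕ, α = ∑ b ∈ Pi, (c b : ℝ) • b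

/-- The Weyl vector: half the sum of the positive roots. -/
noncomputable def weylVec {V : Type} [AddCommGroup V] [Module ℝ V] {S : RootSys V}
    (B : Base S) : V := (2 : ℝ)⁻¹ • ∑ α ∈ B.Pos, α

/-- The coroot lattice `Q(R^∨)`, generated by the coroots `α^∨ = (2/I(α,α))•α`. -/
noncomputable def corootLat {V : Type} [AddCommGroup V] [Module ℝ V] (S : RootSys V) :
    AddSubgroup V := AddSubgroup.closure {x : V | ∃ α ∈ S.R, x = (2 / S.I α α) • α}

/-- Membership in the algebra `ℰ`: viewing an element of `ℰ` as the function
`F̂ → ℝ` recording its coefficients, its support must be contained in a finite union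
of sets of the form `μ − Σ_{i=0}^l ℤ_{≥0} α_i`, where `α₀` is the affine simple root
and `α_1, …, α_l ∈ Π_f` are the finite simple roots. -/
def memE {V : Type} [AddCommGroup V] [Module ℝ V] {S : RootSys V} (B : Base S)
    (α₀ : HatV V) (f : HatV V → ℝ) : Prop :=
  ∃ (r : ℕ) (μ : Fin r → HatV V), ∀ p : HatV V, f p ≠ 0 →
    ∃ (i : Fin r) (k : ℕ) (m : V → ℕ),
      p = μ i - (k : ℝ) • α₀ - embH (∑ b ∈ B.Pi, (m b : ℝ) • b)

section SignedSums

variable {J M : Type*} [AddCommGroup M]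

/-- The coefficient of `e^{-μ}` in `∏_j (1 - e^{-v j})`. -/
noncomputable def prodCoeff (v : J → M) (μ : M) : ℝ :=
  ∑' T : Finset J, if ∑ j ∈ T, v j = μ then (-1 : ℝ) ^ T.card else 0

/-- The coefficient of `e^{-μ}` in `∏_{j ≠ i} (1 - e^{-v j})`. -/
noncomputable def prodCoeffErase (v : J → M) (i : J) (μ : M) : ℝ :=
  ∑' T : Finset J, if i ∉ T ∧ ∑ j ∈ T, v j = μ then (-1 : ℝ) ^ T.card else 0

theorem exists_of_prodCoeff_ne_zero {v : J → M} {μ : M} (hμ : prodCoeff v μ ≠ 0) :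
    ∃ T : Finset J, ∑ j ∈ T, v j = μ := by
  by_contra! H
  exact hμ (by simp [prodCoeff, H])

theorem exists_of_prodCoeffErase_ne_zero {v : J → M} {i : J} {μ : M}
    (hμ : prodCoeffErase v i μ ≠ 0) : ∃ T : Finset J, ∑ j ∈ T, v j = μ := by
  by_contra! H
  exact hμ (by simp [prodCoeffErase, H])

theorem tsum_mem_eq_neg_erase (v : J → M) (i : J) (μ : M) :
    (∑' T : Finset J, if i ∈ T ∧ ∑ j ∈ T, v j = μ then (-1 : ℝ) ^ T.card else 0)
      = - prodCoeffErase v i (μ - v i) := by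
  have hinv : Function.Involutive (fun T : Finset J => symmDiff T {i}) := fun T => by simp
  rw [prodCoeffErase, ← tsum_neg, ← (hinv.toPerm _).tsum_eq]
  refine tsum_congr fun T => ?_
  have hP : hinv.toPerm _ T = symmDiff T {i} := rfl
  by_cases hi : i ∈ T
  · rw [if_neg (by rw [hP]; simp [hi, Finset.mem_symmDiff]), if_neg (by simp [hi]), neg_zero]
  · have hT : hinv.toPerm _ T = insert i T := by
      rw [hP]
      ext x; simp only [Finset.mem_symmDiff, Finset.mem_insert, Finset.mem_singleton]
      by_cases hx : x = i <;> simp [hx, hi]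
    have hsum : ∑ j ∈ hinv.toPerm _ T, v j = v i + ∑ j ∈ T, v j := by
      rw [hT, Finset.sum_insert hi]
    have hcard : (hinv.toPerm _ T).card = T.card + 1 := by
      rw [hT, Finset.card_insert_of_notMem hi]
    by_cases hs : ∑ j ∈ T, v j = μ - v i
    · rw [if_pos ⟨by rw [hT]; simp, by rw [hsum, hs]; abel⟩, if_pos ⟨hi, hs⟩, hcard, pow_succ]
      ring
    · rw [if_neg, if_neg (by simp [hs]), neg_zero]
      rintro ⟨-, h2⟩
      exact hs (by rw [← h2, hsum]; abel)

theorem prodCoeff_comp_equiv {J' : Type*} (e : J' ≃ J) (v : J → M) (μ : M) :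
    prodCoeff (v ∘ e) μ = prodCoeff v μ := by
  rw [prodCoeff, prodCoeff, ← (Equiv.finsetCongr e).tsum_eq]
  refine tsum_congr fun T => ?_
  simp

variable [Module ℝ M]

/-- A family of vectors of degree at least one, finitely many in each bounded range of degrees. -/
structure Graded (h : M →ₗ[ℝ] ℝ) (v : J → M) : Prop where
  one_le : ∀ j, 1 ≤ h (v j)
  finite : ∀ N : ℝ, {j | h (v j) ≤ N}.Finite

namespace Graded

variable {h : M →ₗ[ℝ] ℝ} {v : J → M}

theorem le_of_mem (hv : Graded h v) {T : Finset J} {j : J} (hj : j ∈ T) :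
    h (v j) ≤ h (∑ j ∈ T, v j) := by
  rw [map_sum]
  exact Finset.single_le_sum (f := fun j => h (v j))
    (fun i _ => zero_le_one.trans (hv.one_le i)) hj

theorem sum_nonneg (hv : Graded h v) (T : Finset J) : 0 ≤ h (∑ j ∈ T, v j) := by
  rw [map_sum]
  exact Finset.sum_nonneg fun i _ => zero_le_one.trans (hv.one_le i)

theorem finite_le (hv : Graded h v) (N : ℝ) : {T : Finset J | h (∑ j ∈ T, v j) ≤ N}.Finite := by
  refine ((hv.finite N).toFinset.powerset.finite_toSet).subset fun T hT => ?_
  simp only [Finset.coe_powerset, Set.mem_preimage, Set.mem_powerset_iff]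
  intro j hj
  simpa using (hv.le_of_mem hj).trans hT

theorem finite_eq (hv : Graded h v) (μ : M) : {T : Finset J | ∑ j ∈ T, v j = μ}.Finite :=
  (hv.finite_le (h μ)).subset fun T hT => by
    simp only [Set.mem_ofPred_eq] at hT ⊢; rw [hT]

theorem summable (hv : Graded h v) (μ : M) (F : Finset J → ℝ)
    (hF : ∀ T, F T ≠ 0 → ∑ j ∈ T, v j = μ) : Summable F :=
  summable_of_hasFiniteSupport ((hv.finite_eq μ).subset fun T hT => hF T hT)

theorem prodCoeff_ne_zero (hv : Graded h v) {μ : M} (hμ : prodCoeff v μ ≠ 0) :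
    μ = 0 ∨ 1 ≤ h μ := by
  obtain ⟨T, rfl⟩ := exists_of_prodCoeff_ne_zero hμ
  rcases T.eq_empty_or_nonempty with rfl | ⟨j, hj⟩
  · simp
  · exact Or.inr ((hv.one_le j).trans (hv.le_of_mem hj))

theorem prodCoeff_zero (hv : Graded h v) : prodCoeff v 0 = 1 := by
  unfold prodCoeff
  rw [tsum_eq_single ∅]
  · simp
  · intro T hT
    rw [if_neg]
    intro h0
    obtain ⟨j, hj⟩ := Finset.nonempty_iff_ne_empty.mpr hT
    have h1 := hv.le_of_mem hj
    rw [h0, map_zero] at h1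
    linarith [hv.one_le j]

theorem prodCoeff_eq_erase (hv : Graded h v) (i : J) (μ : M) :
    prodCoeff v μ = prodCoeffErase v i μ - prodCoeffErase v i (μ - v i) := by
  rw [sub_eq_add_neg, ← tsum_mem_eq_neg_erase, prodCoeffErase, prodCoeff, ← Summable.tsum_add]
  · refine tsum_congr fun T => ?_
    by_cases hi : i ∈ T <;> simp [hi]
  · exact hv.summable μ _ fun T hT => by
      by_contra H; exact hT (by simp [H])
  · exact hv.summable μ _ fun T hT => by
      by_contra H; exact hT (by simp [H])

theorem prodCoeffErase_eq_zero (hv : Graded h v) {i : J} {μ : M} (hμ : h μ < 0) :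
    prodCoeffErase v i μ = 0 := by
  by_contra H
  obtain ⟨T, rfl⟩ := exists_of_prodCoeffErase_ne_zero H
  exact absurd (hv.sum_nonneg T) (not_le.mpr hμ)

theorem prodCoeff_eq_zero (hv : Graded h v) {μ : M} (hμ : h μ < 0) : prodCoeff v μ = 0 := by
  by_contra H
  obtain ⟨T, rfl⟩ := exists_of_prodCoeff_ne_zero H
  exact absurd (hv.sum_nonneg T) (not_le.mpr hμ)

theorem prodCoeffErase_eq_tsum (hv : Graded h v) (i : J) (μ : M) :
    prodCoeffErase v i μ = ∑' k : ℕ, prodCoeff v (μ - (k : ℝ) • v i) := by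
  have key : ∀ n : ℕ, prodCoeffErase v i μ =
      ∑ k ∈ Finset.range n, prodCoeff v (μ - (k : ℝ) • v i)
        + prodCoeffErase v i (μ - (n : ℝ) • v i) := by
    intro n
    induction n with
    | zero => simp
    | succ n ih =>
      rw [ih, Finset.sum_range_succ, hv.prodCoeff_eq_erase i,
        show μ - (n : ℝ) • v i - v i = μ - ((n + 1 : ℕ) : ℝ) • v i by push_cast; module]
      ring
  obtain ⟨n, hn⟩ := exists_nat_gt (h μ)
  have hneg : ∀ k : ℕ, n ≤ k → h (μ - (k : ℝ) • v i) < 0 := by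
    intro k hk
    have h1 := hv.one_le i
    have h2 : (n : ℝ) ≤ k := by exact_mod_cast hk
    have h3 : (k : ℝ) ≤ k * h (v i) := le_mul_of_one_le_right (by positivity) h1
    simp only [map_sub, map_smul, smul_eq_mul]
    linarith
  rw [key n, hv.prodCoeffErase_eq_zero (hneg n le_rfl), add_zero, tsum_eq_sum]
  intro k hk
  exact hv.prodCoeff_eq_zero (hneg k (by simpa using hk))

/-- The family of positive multiples of a graded family. -/
def multiples (v : J → M) (a : J × ℕ) : M := ((a.2 : ℝ) + 1) • v a.1

theorem graded_multiples (hv : Graded h v) : Graded h (multiples v) := by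
  have key : ∀ a : J × ℕ, h (v a.1) ≤ h (multiples v a) ∧ (a.2 : ℝ) + 1 ≤ h (multiples v a) := by
    intro a
    have h1 := hv.one_le a.1
    have h2 : (0 : ℝ) ≤ a.2 := by positivity
    simp only [multiples, map_smul, smul_eq_mul]
    constructor <;> nlinarith
  refine ⟨fun a => (hv.one_le _).trans (key a).1, fun N => ?_⟩
  obtain ⟨n, hn⟩ := exists_nat_gt N
  refine ((hv.finite N).prod (Set.finite_Iio n)).subset fun a ha => ?_
  simp only [Set.mem_ofPred_eq] at ha
  refine ⟨(key a).1.trans ha, ?_⟩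
  have h2 := (key a).2
  have : (a.2 : ℝ) < n := by linarith
  exact_mod_cast this

theorem graded_sum_pairs {K : Type*} {u : K → M} (hu : Graded h u) :
    Graded h (Sum.elim u fun p : K × K => u p.1 + u p.2) := by
  refine ⟨?_, fun N => ?_⟩
  · rintro (a | p)
    · exact hu.one_le a
    · simp only [Sum.elim_inr, map_add]; linarith [hu.one_le p.1, hu.one_le p.2]
  · refine (((hu.finite N).image Sum.inl).union
      (((hu.finite N).prod (hu.finite N)).image Sum.inr)).subset ?_
    rintro (a | p) ha
    · exact Or.inl ⟨a, ha, rfl⟩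
    · refine Or.inr ⟨p, ⟨?_, ?_⟩, rfl⟩ <;>
      · simp only [Sum.elim_inr, map_add, Set.mem_ofPred_eq] at ha ⊢
        linarith [hu.one_le p.1, hu.one_le p.2]

theorem summable_shift {K : Type*} {u : K → M} (hu : Graded h u) (hv : Graded h v)
    (g : K → ℝ) (μ : M) : Summable fun a => g a * prodCoeff v (μ - u a) := by
  refine summable_of_hasFiniteSupport ((hu.finite (h μ)).subset fun a ha => ?_)
  have h1 : prodCoeff v (μ - u a) ≠ 0 := fun h0 => ha (by simp [h0])
  by_contra H
  refine h1 (hv.prodCoeff_eq_zero ?_)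
  simp only [Set.mem_ofPred_eq, not_le] at H
  rw [map_sub]; linarith

/-- The logarithmic derivative of the product, along a linear functional. -/
theorem neg_mul_prodCoeff (hv : Graded h v) (φ : M →ₗ[ℝ] ℝ) (μ : M) :
    -(φ μ * prodCoeff v μ) = ∑' a : J × ℕ, φ (v a.1) * prodCoeff v (μ - multiples v a) := by
  rw [Summable.tsum_prod (hv.graded_multiples.summable_shift hv (fun a => φ (v a.1)) μ)]
  have h1 : ∀ j : J, (∑' k : ℕ, φ (v j) * prodCoeff v (μ - multiples v (j, k)))
      = - ∑' T : Finset J, if j ∈ T ∧ ∑ j ∈ T, v j = μ then φ (v j) * (-1 : ℝ) ^ T.card else 0 := by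
    intro j
    have e1 : ∀ T : Finset J, (if j ∈ T ∧ ∑ j ∈ T, v j = μ then φ (v j) * (-1 : ℝ) ^ T.card else 0)
      = φ (v j) * (if j ∈ T ∧ ∑ j ∈ T, v j = μ then (-1 : ℝ) ^ T.card else 0) := by
      intro T; rw [mul_ite, mul_zero]
    simp_rw [e1, tsum_mul_left]
    rw [tsum_mem_eq_neg_erase, hv.prodCoeffErase_eq_tsum, mul_neg, neg_neg]
    congr 1
    refine tsum_congr fun k => ?_
    congr 1
    simp only [multiples]; module
  simp_rw [h1]
  rw [tsum_neg, neg_inj, Summable.tsum_comm]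
  · rw [prodCoeff, ← tsum_mul_left]
    refine tsum_congr fun T => ?_
    by_cases hT : ∑ j ∈ T, v j = μ
    · rw [tsum_eq_sum (s := T) (fun j hj => by simp [hj]), if_pos hT, ← hT, map_sum, Finset.sum_mul]
      exact Finset.sum_congr rfl fun j hj => by simp [hj]
    · simp [hT]
  · refine summable_of_hasFiniteSupport
      (((hv.finite_eq μ).prod (hv.finite (h μ))).subset ?_)
    rintro ⟨T, j⟩ hjT
    have hc : j ∈ T ∧ ∑ j ∈ T, v j = μ := by
      by_contra H; exact hjT (by simp only [Function.uncurry]; rw [if_neg H])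
    exact ⟨hc.2, by have := hv.le_of_mem hc.1; rwa [hc.2] at this⟩

/-- The coefficients of the second logarithmic derivative of the product. -/
def laplaceCoeff (v : J → M) (D : M →ₗ[ℝ] M →ₗ[ℝ] ℝ) (ψ : M →ₗ[ℝ] ℝ) :
    (J × ℕ) ⊕ ((J × ℕ) × (J × ℕ)) → ℝ :=
  Sum.elim (fun a => 2 * ψ (v a.1) - D (v a.1) (multiples v a))
    fun p => D (v p.1.1) (v p.2.1)

/-- The exponents of the second logarithmic derivative of the product. -/
def laplaceVec (v : J → M) : (J × ℕ) ⊕ ((J × ℕ) × (J × ℕ)) → M :=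
  Sum.elim (multiples v) fun p => multiples v p.1 + multiples v p.2

theorem graded_laplaceVec (hv : Graded h v) : Graded h (laplaceVec v) :=
  hv.graded_multiples.graded_sum_pairs

theorem laplace_mul_prodCoeff (hv : Graded h v) (D : M →ₗ[ℝ] M →ₗ[ℝ] ℝ) (ψ : M →ₗ[ℝ] ℝ) (μ : M) :
    (D μ μ - 2 * ψ μ) * prodCoeff v μ =
      ∑' x, laplaceCoeff v D ψ x * prodCoeff v (μ - laplaceVec v x) := by
  have hm := hv.graded_multiples
  have hL := hv.graded_laplaceVec
  have hs := hL.summable_shift hv (laplaceCoeff v D ψ) μ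
  have hsl : Summable ((fun x => laplaceCoeff v D ψ x * prodCoeff v (μ - laplaceVec v x)) ∘
      Sum.inl) :=
    hs.comp_injective Sum.inl_injective
  have hsr : Summable ((fun x => laplaceCoeff v D ψ x * prodCoeff v (μ - laplaceVec v x)) ∘
      Sum.inr) :=
    hs.comp_injective Sum.inr_injective
  rw [Summable.tsum_sum hsl hsr, Summable.tsum_prod (f := fun p => laplaceCoeff v D ψ (Sum.inr p) *
    prodCoeff v (μ - laplaceVec v (Sum.inr p))) hsr]
  have h2 : ∀ a : J × ℕ, (∑' b : J × ℕ,
      laplaceCoeff v D ψ (Sum.inr (a, b)) * prodCoeff v (μ - laplaceVec v (Sum.inr (a, b))))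
      = -(D (v a.1) μ * prodCoeff v (μ - multiples v a))
        + D (v a.1) (multiples v a) * prodCoeff v (μ - multiples v a) := by
    intro a
    have := hv.neg_mul_prodCoeff (D (v a.1)) (μ - multiples v a)
    simp only [laplaceCoeff, laplaceVec, Sum.elim_inr, ← sub_sub]
    rw [← this, map_sub]; ring
  simp_rw [h2]
  rw [Summable.tsum_add (hm.summable_shift hv (fun a => D (v a.1) μ) μ).neg
    (hm.summable_shift hv (fun a => D (v a.1) (multiples v a)) μ), tsum_neg]
  have h3 := hv.neg_mul_prodCoeff (D.flip μ) μ
  have h4 := hv.neg_mul_prodCoeff ψ μ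
  simp only [LinearMap.flip_apply] at h3
  rw [← h3]
  simp only [laplaceCoeff, laplaceVec, Sum.elim_inl, sub_mul, mul_assoc]
  rw [Summable.tsum_sub ((hm.summable_shift hv (fun a => ψ (v a.1)) μ).mul_left 2)
    (hm.summable_shift hv (fun a => D (v a.1) (multiples v a)) μ), tsum_mul_left, ← h4]
  ring

/-- The lowest coefficient of a convolution with `prodCoeff`. -/
theorem lowest_coeff {X : Type*} {w : X → M} (hw : Graded h w) (hv : Graded h v) (g : X → ℝ)
    {d : M → ℝ} (hd : ∀ μ, d μ = ∑' x, g x * prodCoeff v (μ - w x)) {μ₀ : M}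
    (hlow : ∀ μ, h μ < h μ₀ → d μ = 0) :
    d μ₀ = ∑' x, if w x = μ₀ then g x else 0 := by
  have main : ∀ n : ℕ, ∀ ν : M, h ν < n → h ν ≤ h μ₀ →
      d ν = ∑' x, if w x = ν then g x else 0 := by
    intro n
    induction n with
    | zero =>
      intro ν hν _
      simp only [Nat.cast_zero] at hν
      rw [hd]
      refine tsum_congr fun x => ?_
      rw [hv.prodCoeff_eq_zero, mul_zero, if_neg]
      · rintro rfl; linarith [hw.one_le x]
      · rw [map_sub]; linarith [hw.one_le x]
    | succ n ih =>
      intro ν hν hν₀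
      set S := (hw.finite (h ν)).toFinset with hS
      have hG : ∀ m : M, h m ≤ h ν →
          (∑' x, if w x = m then g x else 0) = ∑ x ∈ S, if w x = m then g x else 0 := by
        intro m hm
        refine tsum_eq_sum fun x hx => if_neg ?_
        rintro rfl
        exact hx (by simpa [hS] using hm)
      have h1 : d ν = ∑ m ∈ S.image w, prodCoeff v (ν - m) *
          ∑' x, if w x = m then g x else 0 := by
        rw [hd, tsum_eq_sum (s := S), ← Finset.sum_fiberwise_of_maps_to
          (g := w) (t := S.image w) (fun x hx => Finset.mem_image_of_mem w hx)]
        · refine Finset.sum_congr rfl fun m hm => ?_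
          obtain ⟨y, hy, rfl⟩ := Finset.mem_image.mp hm
          rw [hG _ (by simpa [hS] using hy), Finset.mul_sum, Finset.sum_filter]
          refine Finset.sum_congr rfl fun x _ => ?_
          split_ifs with hx
          · rw [hx, mul_comm]
          · simp
        · intro x hx
          rw [hv.prodCoeff_eq_zero, mul_zero]
          have : ¬ h (w x) ≤ h ν := by simpa [hS] using hx
          rw [map_sub]; linarith
      rw [h1, Finset.sum_eq_single ν]
      · rw [sub_self, hv.prodCoeff_zero, one_mul]
      · intro m hm hne
        rcases eq_or_ne (prodCoeff v (ν - m)) 0 with h0 | h0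
        · rw [h0, zero_mul]
        · rcases hv.prodCoeff_ne_zero h0 with h2 | h2
          · exact absurd (sub_eq_zero.mp h2).symm hne
          · rw [map_sub] at h2
            push_cast at hν
            rw [← ih m (by linarith) (by linarith), hlow m (by linarith), mul_zero]
      · intro hν'
        rw [hG ν le_rfl, Finset.sum_eq_zero, mul_zero]
        intro x hx
        refine if_neg ?_
        rintro rfl
        exact hν' (Finset.mem_image_of_mem w hx)
  obtain ⟨n, hn⟩ := exists_nat_gt (h μ₀)
  exact main n μ₀ hn le_rfl

/-- Antisymmetry of the product under a reflection that permutes all factors but one. -/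
theorem prodCoeff_antisymm (hv : Graded h v) (i : J) (s : M →ₗ[ℝ] M) (hs : ∀ x, s (s x) = x)
    (hi : s (v i) = - v i) (σ : Equiv.Perm J) (hσi : σ i = i)
    (hσ : ∀ j, j ≠ i → v (σ j) = s (v j)) (μ : M) :
    prodCoeff v (s μ + v i) = - prodCoeff v μ := by
  have key : ∀ ν, prodCoeffErase v i (s ν) = prodCoeffErase v i ν := by
    intro ν
    rw [prodCoeffErase, prodCoeffErase, ← (Equiv.finsetCongr σ).tsum_eq]
    refine tsum_congr fun T => ?_
    have h1 : i ∈ T.map σ.toEmbedding ↔ i ∈ T := by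
      rw [Finset.mem_map_equiv, σ.symm_apply_eq.mpr hσi.symm]
    rw [Equiv.finsetCongr_apply, Finset.card_map, Finset.sum_map]
    by_cases hiT : i ∈ T
    · simp [hiT, σ.symm_apply_eq.mpr hσi.symm]
    · have h2 : ∑ x ∈ T, v (σ.toEmbedding x) = s (∑ x ∈ T, v x) := by
        rw [map_sum]
        refine Finset.sum_congr rfl fun x hx => hσ x ?_
        rintro rfl; exact hiT hx
      rw [h2]
      have h3 : s (∑ x ∈ T, v x) = s ν ↔ ∑ x ∈ T, v x = ν :=
        (Function.LeftInverse.injective hs).eq_iff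
      exact if_congr (and_congr (not_congr h1) h3) rfl rfl
  have e1 : s μ + v i = s (μ - v i) := by rw [map_sub, hi]; abel
  rw [hv.prodCoeff_eq_erase i, hv.prodCoeff_eq_erase i μ, add_sub_cancel_right, e1, key, key]
  ring

end Graded

/-- Splitting off finitely many factors of the product. -/
theorem prodCoeff_sumElim {A : Type*} {h : M →ₗ[ℝ] ℝ} {w : A → M} {v : J → M}
    (S : Finset (Finset A)) (hS : ∀ T, T ∈ S)
    (hwv : Graded h (Sum.elim w v)) (μ : M) :
    prodCoeff (Sum.elim w v) μ =
      ∑ T ∈ S, (-1 : ℝ) ^ T.card * prodCoeff v (μ - ∑ a ∈ T, w a) := by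
  have hsum : Summable fun p : Finset A × Finset J =>
      if ∑ a ∈ p.1, w a + ∑ j ∈ p.2, v j = μ then (-1 : ℝ) ^ (p.1.card + p.2.card) else 0 := by
    refine summable_of_hasFiniteSupport (((hwv.finite_eq μ).image
      (Finset.sumEquiv (α := A) (β := J)).toEquiv).subset ?_)
    rintro p hp
    refine ⟨p.1.disjSum p.2, ?_, ?_⟩
    · have : ∑ a ∈ p.1, w a + ∑ j ∈ p.2, v j = μ := by
        by_contra H; exact hp (by simp [H])
      simp [Finset.sum_disjSum, this]
    · exact (Finset.sumEquiv (α := A) (β := J)).apply_symm_apply p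
  rw [prodCoeff, ← (Finset.sumEquiv (α := A) (β := J)).symm.toEquiv.tsum_eq]
  have e1 : ∀ p : Finset A × Finset J,
      (if ∑ j ∈ (Finset.sumEquiv (α := A) (β := J)).symm.toEquiv p, Sum.elim w v j = μ
        then (-1 : ℝ) ^ ((Finset.sumEquiv (α := A) (β := J)).symm.toEquiv p).card else 0)
      = if ∑ a ∈ p.1, w a + ∑ j ∈ p.2, v j = μ then (-1 : ℝ) ^ (p.1.card + p.2.card) else 0 := by
    intro p
    have : (Finset.sumEquiv (α := A) (β := J)).symm.toEquiv p = p.1.disjSum p.2 := rfl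
    rw [this, Finset.card_disjSum, Finset.sum_disjSum]
    exact if_congr (by simp) rfl rfl
  rw [tsum_congr e1, Summable.tsum_prod hsum, tsum_eq_sum (s := S) (fun T hT => absurd (hS T) hT)]
  refine Finset.sum_congr rfl fun T _ => ?_
  rw [prodCoeff, ← tsum_mul_left]
  refine tsum_congr fun T' => ?_
  rw [mul_ite, mul_zero, pow_add]
  exact if_congr eq_sub_iff_add_eq'.symm rfl rfl

end SignedSums

namespace RootSys

variable {V : Type} [AddCommGroup V] [Module ℝ V] (S : RootSys V)

theorem ne_zero {α : V} (hα : α ∈ S.R) : α ≠ 0 := fun h => S.zero_notmem (h ▸ hα)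

theorem form_pos {α : V} (hα : α ∈ S.R) : 0 < S.I α α := S.posdef α (S.ne_zero hα)

theorem form_self_nonneg (x : V) : 0 ≤ S.I x x := by
  rcases eq_or_ne x 0 with rfl | hx
  · simp
  · exact (S.posdef x hx).le

/-- The functional `x ↦ I(x, α^∨)`. -/
noncomputable def pair (α : V) : V →ₗ[ℝ] ℝ := (2 / S.I α α) • S.I α

theorem pair_apply (α x : V) : S.pair α x = 2 / S.I α α * S.I α x := by simp [pair]

theorem pair_mul {α : V} (hα : α ≠ 0) (x : V) : S.pair α x * S.I α α = 2 * S.I α x := by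
  have := (S.posdef α hα).ne'
  rw [pair_apply]; field_simp

theorem pair_self {α : V} (hα : α ≠ 0) : S.pair α α = 2 := by
  have := (S.posdef α hα).ne'
  rw [pair_apply]; field_simp

theorem refl_aux (α x : V) :
    (x - S.pair α x • α) - S.pair α (x - S.pair α x • α) • α = x := by
  rcases eq_or_ne α 0 with rfl | hα
  · simp
  · rw [map_sub, map_smul, S.pair_self hα, smul_eq_mul]; module

/-- The orthogonal reflection in `α`. -/
noncomputable def refl (α : V) : V ≃ₗ[ℝ] V :=
  LinearEquiv.ofInvolutive (LinearMap.id - (S.pair α).smulRight α) fun x => by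
    simpa using S.refl_aux α x

theorem refl_apply (α x : V) : S.refl α x = x - S.pair α x • α := by
  change (LinearMap.id - (S.pair α).smulRight α : V →ₗ[ℝ] V) x = _
  simp

@[simp] theorem refl_refl (α x : V) : S.refl α (S.refl α x) = x := by
  rw [refl_apply, refl_apply, refl_aux]

theorem refl_mul_self (α : V) : S.refl α * S.refl α = 1 := LinearEquiv.ext fun x => S.refl_refl α x

theorem refl_self {α : V} (hα : α ≠ 0) : S.refl α α = -α := by
  rw [refl_apply, S.pair_self hα]; module

theorem form_refl (α x y : V) : S.I (S.refl α x) (S.refl α y) = S.I x y := by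
  rcases eq_or_ne α 0 with rfl | hα
  · simp [refl_apply]
  · have h1 := S.pair_mul hα x
    have h2 := S.pair_mul hα y
    simp only [refl_apply, map_sub, map_smul, LinearMap.sub_apply, LinearMap.smul_apply,
      smul_eq_mul]
    rw [S.symm x α]
    linear_combination (S.pair α y) * h1 / 2 + (S.pair α x) * h2 / 2

theorem form_refl_left (α x y : V) : S.I (S.refl α x) y = S.I x (S.refl α y) := by
  rw [← S.form_refl α (S.refl α x), refl_refl]

theorem refl_mem {α β : V} (hα : α ∈ S.R) (hβ : β ∈ S.R) : S.refl α β ∈ S.R := by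
  have := S.reflect α hα β hβ
  simpa [refl_apply, pair] using this

theorem pair_int {α β : V} (hα : α ∈ S.R) (hβ : β ∈ S.R) : ∃ n : ℤ, S.pair α β = n := by
  simpa [pair] using S.integral α hα β hβ

theorem neg_mem {α : V} (hα : α ∈ S.R) : -α ∈ S.R := by
  rw [← S.refl_self (S.ne_zero hα)]; exact S.refl_mem hα hα

theorem refl_mem_weyl {α : V} (hα : α ∈ S.R) : S.refl α ∈ Weyl S := by
  refine Subgroup.subset_closure ⟨α, hα, fun x => ?_⟩
  rw [refl_apply, pair_apply]; congr 2; ring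

theorem weyl_eq_closure : Weyl S = Subgroup.closure {u | ∃ α ∈ S.R, u = S.refl α} := by
  unfold Weyl
  congr 1
  ext u
  refine exists_congr fun α => and_congr_right fun _ => ?_
  constructor
  · intro h
    ext x
    rw [h, refl_apply, pair_apply]; congr 2; ring
  · rintro rfl x
    rw [refl_apply, pair_apply]; congr 2; ring

theorem det_refl [FiniteDimensional ℝ V] {α : V} (hα : α ≠ 0) :
    LinearMap.det ((S.refl α : V ≃ₗ[ℝ] V) : V →ₗ[ℝ] V) = -1 := by
  have : ((S.refl α : V ≃ₗ[ℝ] V) : V →ₗ[ℝ] V) = LinearMap.transvection (S.pair α) (-α) := by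
    ext x
    simp [refl_apply, LinearMap.transvection.apply, sub_eq_add_neg]
  rw [this, LinearMap.transvection.det, map_neg, S.pair_self hα]
  norm_num

theorem weyl_induction {P : (V ≃ₗ[ℝ] V) → Prop} (h1 : P 1)
    (hs : ∀ α ∈ S.R, ∀ u, P u → P (S.refl α * u)) {u : V ≃ₗ[ℝ] V} (hu : u ∈ Weyl S) : P u := by
  rw [weyl_eq_closure] at hu
  induction hu using Subgroup.closure_induction_left with
  | one => exact h1
  | mul_left x hx y _ ih => obtain ⟨α, hα, rfl⟩ := hx; exact hs α hα y ih
  | inv_mul_cancel x hx y _ ih =>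
    obtain ⟨α, hα, rfl⟩ := hx
    rw [inv_eq_of_mul_eq_one_left (S.refl_mul_self α)]
    exact hs α hα y ih

theorem form_weyl {u : V ≃ₗ[ℝ] V} (hu : u ∈ Weyl S) (x y : V) : S.I (u x) (u y) = S.I x y := by
  refine S.weyl_induction (P := fun u => S.I (u x) (u y) = S.I x y) rfl (fun α _ u ih => ?_) hu
  rw [LinearEquiv.mul_apply, LinearEquiv.mul_apply, form_refl, ih]

theorem weyl_mem {u : V ≃ₗ[ℝ] V} (hu : u ∈ Weyl S) {β : V} (hβ : β ∈ S.R) : u β ∈ S.R := by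
  exact S.weyl_induction (P := fun u => u β ∈ S.R) hβ (fun α hα u ih => S.refl_mem hα ih) hu

theorem coroot_mem {α : V} (hα : α ∈ S.R) : (2 / S.I α α) • α ∈ corootLat S :=
  AddSubgroup.subset_closure ⟨α, hα, rfl⟩

theorem weyl_mem_corootLat {u : V ≃ₗ[ℝ] V} (hu : u ∈ Weyl S) {y : V} (hy : y ∈ corootLat S) :
    u y ∈ corootLat S := by
  induction hy using AddSubgroup.closure_induction with
  | mem x hx =>
    obtain ⟨α, hα, rfl⟩ := hx
    rw [map_smul, ← S.form_weyl hu α α]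
    exact S.coroot_mem (S.weyl_mem hu hα)
  | zero => simp
  | add x y _ _ hx hy => rw [map_add]; exact AddSubgroup.add_mem _ hx hy
  | neg x _ hx => rw [map_neg]; exact AddSubgroup.neg_mem _ hx

theorem weyl_mem_corootLat_iff {u : V ≃ₗ[ℝ] V} (hu : u ∈ Weyl S) {y : V} :
    u y ∈ corootLat S ↔ y ∈ corootLat S := by
  refine ⟨fun h => ?_, S.weyl_mem_corootLat hu⟩
  have := S.weyl_mem_corootLat (inv_mem hu) h
  rwa [← LinearEquiv.mul_apply, inv_mul_cancel] at this

theorem corootLat_int {y : V} (hy : y ∈ corootLat S) {α : V} (hα : α ∈ S.R) :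
    ∃ n : ℤ, S.I α y = n := by
  induction hy using AddSubgroup.closure_induction with
  | mem x hx =>
    obtain ⟨β, hβ, rfl⟩ := hx
    obtain ⟨n, hn⟩ := S.pair_int hβ hα
    exact ⟨n, by rw [← hn, pair_apply, map_smul, S.symm α β, smul_eq_mul]⟩
  | zero => exact ⟨0, by simp⟩
  | add x y _ _ hx hy =>
    obtain ⟨n, hn⟩ := hx
    obtain ⟨m, hm⟩ := hy
    exact ⟨n + m, by rw [map_add, hn, hm]; push_cast; ring⟩
  | neg x _ hx =>
    obtain ⟨n, hn⟩ := hx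
    exact ⟨-n, by rw [map_neg, hn]; push_cast; ring⟩

theorem sum_refl {A : Type*} [AddCommMonoid A] {β : V} (hβ : β ∈ S.R) (F : V → A) :
    ∑ α ∈ S.R, F (S.refl β α) = ∑ α ∈ S.R, F α :=
  Finset.sum_nbij' (S.refl β) (S.refl β) (fun _ h => S.refl_mem hβ h) (fun _ h => S.refl_mem hβ h)
    (fun _ _ => S.refl_refl _ _) (fun _ _ => S.refl_refl _ _) fun _ _ => rfl

/-- The operator `x ↦ Σ_α I(α, x) α`. -/
noncomputable def casimir : V →ₗ[ℝ] V := ∑ α ∈ S.R, (S.I α).smulRight α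

theorem casimir_apply (x : V) : S.casimir x = ∑ α ∈ S.R, S.I α x • α := by
  simp [casimir, LinearMap.sum_apply]

theorem casimir_refl {β : V} (hβ : β ∈ S.R) (x : V) :
    S.casimir (S.refl β x) = S.refl β (S.casimir x) := by
  rw [casimir_apply, casimir_apply, map_sum, ← S.sum_refl hβ]
  refine Finset.sum_congr rfl fun α _ => ?_
  rw [form_refl, map_smul]

theorem form_casimir (x y : V) : S.I (S.casimir x) y = ∑ α ∈ S.R, S.I α x * S.I α y := by
  simp [casimir_apply, map_sum, LinearMap.sum_apply]

/-- Schur's lemma for the trace form of the root system. -/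
theorem exists_casimir_eq {θ : V} (hθ : θ ∈ S.R) :
    ∃ κ : ℝ, ∀ x, S.casimir x = κ • x := by
  have h1 : ∀ β ∈ S.R, S.casimir β = (S.pair β (S.casimir β) / 2) • β := by
    intro β hβ
    have h2 := S.casimir_refl hβ β
    rw [S.refl_self (S.ne_zero hβ), map_neg, refl_apply] at h2
    have h3 : (2 : ℝ) • S.casimir β = S.pair β (S.casimir β) • β := by
      rw [two_smul, ← sub_eq_zero, ← sub_eq_zero.mpr h2.symm]; abel
    rw [div_eq_inv_mul, mul_smul, ← h3, smul_smul]; norm_num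
  set lam : V → ℝ := fun β => S.pair β (S.casimir β) / 2 with hlam
  have hsym : ∀ x y, S.I (S.casimir x) y = S.I x (S.casimir y) := by
    intro x y
    rw [S.symm x, form_casimir, form_casimir]
    exact Finset.sum_congr rfl fun _ _ => mul_comm _ _
  have hirr := S.irred (S.R.filter fun β => lam β = lam θ) (S.R.filter fun β => ¬ lam β = lam θ)
    (Finset.filter_union_filter_not_eq _ _) (by
      intro α hα β hβ
      rw [Finset.mem_filter] at hα hβ
      have h2 := hsym α β
      rw [h1 α hα.1, h1 β hβ.1] at h2
      simp only [map_smul, LinearMap.smul_apply, smul_eq_mul] at h2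
      by_contra H
      exact hβ.2 ((mul_right_cancel₀ H h2).symm.trans hα.2))
  have hall : ∀ β ∈ S.R, lam β = lam θ := by
    rcases hirr with h2 | h2
    · exact absurd rfl (Finset.filter_eq_empty_iff.mp h2 hθ)
    · intro β hβ
      by_contra H
      exact Finset.filter_eq_empty_iff.mp h2 hβ H
  refine ⟨lam θ, fun x => ?_⟩
  have hx : x ∈ Submodule.span ℝ (S.R : Set V) := by rw [S.spanning]; trivial
  induction hx using Submodule.span_induction with
  | mem y hy => rw [← hall y hy]; exact h1 y hy
  | zero => simp
  | add y z _ _ h1 h2 => rw [map_add, h1, h2, smul_add]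
  | smul a y _ h1 => rw [map_smul, h1, smul_comm]

theorem sum_coroots_eq_zero (n : ℕ) : ∀ L : List V, L.length = n → (∀ α ∈ L, α ∈ S.R) →
    (∀ α ∈ S.R, |S.I α (L.map fun β => (2 / S.I β β) • β).sum| ≤ 1) →
    (L.map fun β => (2 / S.I β β) • β).sum = 0 := by
  induction n with
  | zero => intro L hL _ _; rw [List.length_eq_zero_iff.mp hL]; simp
  | succ n ih =>
    intro L hL hR hmin
    set y := (L.map fun β => (2 / S.I β β) • β).sum with hy
    by_contra hne
    have hyQ : y ∈ corootLat S := AddSubgroup.list_sum_mem _ fun x hx => by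
      obtain ⟨β, hβ, rfl⟩ := List.mem_map.mp hx
      exact S.coroot_mem (hR β hβ)
    obtain ⟨β, hβ, hpos⟩ : ∃ β ∈ L, 0 < S.I β y := by
      by_contra! H
      have h1 : S.I y y = (L.map fun β => S.I y ((2 / S.I β β) • β)).sum := by
        conv_lhs => rw [hy, map_list_sum, List.map_map]
        rfl
      have h2 : (L.map fun β => S.I y ((2 / S.I β β) • β)).sum ≤ 0 := by
        refine (List.sum_le_card_nsmul _ 0 fun x hx => ?_).trans_eq (smul_zero _)
        obtain ⟨β, hβ, rfl⟩ := List.mem_map.mp hx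
        rw [map_smul, smul_eq_mul, S.symm y β]
        exact mul_nonpos_of_nonneg_of_nonpos (by have := S.form_pos (hR β hβ); positivity) (H β hβ)
      linarith [S.posdef y hne]
    have h1 : S.I β y = 1 := by
      obtain ⟨m, hm⟩ := S.corootLat_int hyQ (hR β hβ)
      have h2 := (abs_le.mp (hmin β (hR β hβ))).2
      rw [hm] at h2 hpos ⊢
      norm_cast at h2 hpos ⊢
      omega
    have h2 : ((L.erase β).map fun β => (2 / S.I β β) • β).sum = S.refl β y := by
      have := List.sum_map_erase (fun β => (2 / S.I β β) • β) hβ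
      rw [refl_apply, pair_apply, h1, mul_one, hy, ← this]
      abel
    have h3 := ih (L.erase β) (by rw [List.length_erase_of_mem hβ, hL]; rfl)
      (fun α hα => hR α (List.mem_of_mem_erase hα)) (by
        intro α hα
        rw [h2, ← form_refl_left]
        exact hmin _ (S.refl_mem (hR β hβ) hα))
    rw [h2] at h3
    exact hne ((S.refl β).map_eq_zero_iff.mp h3)

/-- No nonzero element of the coroot lattice is minuscule. -/
theorem eq_zero_of_minuscule {y : V} (hy : y ∈ corootLat S)
    (hmin : ∀ α ∈ S.R, |S.I α y| ≤ 1) : y = 0 := by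
  obtain ⟨L, hL, rfl⟩ : ∃ L : List V, (∀ α ∈ L, α ∈ S.R) ∧
      y = (L.map fun α => (2 / S.I α α) • α).sum := by
    clear hmin
    induction hy using AddSubgroup.closure_induction with
    | mem x hx => obtain ⟨α, hα, rfl⟩ := hx; exact ⟨[α], by simpa using hα, by simp⟩
    | zero => exact ⟨[], by simp, by simp⟩
    | add x y _ _ hx hy =>
      obtain ⟨L, hL, rfl⟩ := hx
      obtain ⟨L', hL', rfl⟩ := hy
      exact ⟨L ++ L', fun α hα => (List.mem_append.mp hα).elim (hL α) (hL' α), by simp⟩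
    | neg x _ hx =>
      obtain ⟨L, hL, rfl⟩ := hx
      refine ⟨L.map fun α => -α, fun α hα => ?_, ?_⟩
      · obtain ⟨β, hβ, rfl⟩ := List.mem_map.mp hα
        exact S.neg_mem (hL β hβ)
      · rw [List.map_map, List.sum_neg, List.map_map]
        congr 2
        ext α
        simp
  exact S.sum_coroots_eq_zero _ L rfl hL hmin

end RootSys

namespace Base

variable {V : Type} [AddCommGroup V] [Module ℝ V] {S : RootSys V} (B : Base S)

theorem span_pi : ⊤ ≤ Submodule.span ℝ (Set.range fun b : {x // x ∈ B.Pi} => (b : V)) := by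
  rw [← S.spanning, Submodule.span_le]
  have h : ∀ α ∈ B.Pos, α ∈ Submodule.span ℝ (Set.range fun b : {x // x ∈ B.Pi} => (b : V)) := by
    intro α hα
    obtain ⟨cf, rfl⟩ := B.decomp α hα
    exact Submodule.sum_mem _ fun b hb =>
      Submodule.smul_mem _ _ (Submodule.subset_span ⟨⟨b, hb⟩, rfl⟩)
  intro α hα
  rcases B.mem_or_neg α hα with h1 | h1
  · exact h α h1
  · exact neg_neg α ▸ Submodule.neg_mem _ (h _ h1)

/-- The simple roots as a basis. -/
noncomputable def basis : Module.Basis {x // x ∈ B.Pi} ℝ V := Module.Basis.mk B.indep B.span_pi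

/-- The coordinate along the simple root `b`. -/
noncomputable def co (b : {x // x ∈ B.Pi}) : V →ₗ[ℝ] ℝ := B.basis.coord b

theorem co_simple (b b' : {x // x ∈ B.Pi}) : B.co b (b' : V) = if b' = b then 1 else 0 := by
  have : (b' : V) = B.basis b' := by simp [basis]
  rw [this, co, Module.Basis.coord_apply, Module.Basis.repr_self, Finsupp.single_apply]

theorem sum_co (x : V) : ∑ b, B.co b x • (b : V) = x := by
  conv_rhs => rw [← B.basis.sum_repr x]
  simp [basis, co]

theorem ext_co {x y : V} (h : ∀ b, B.co b x = B.co b y) : x = y := by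
  rw [← B.sum_co x, ← B.sum_co y]
  simp only [h]

theorem co_sum (cf : V → ℕ) (b : {x // x ∈ B.Pi}) :
    B.co b (∑ b ∈ B.Pi, (cf b : ℝ) • b) = cf b := by
  rw [map_sum, ← Finset.sum_coe_sort]
  simp [co_simple]

/-- Nonnegative integral combinations of simple roots. -/
def Nn (x : V) : Prop := ∃ cf : V → ℕ, x = ∑ b ∈ B.Pi, (cf b : ℝ) • b

variable {B}

theorem Nn.exists_co {x : V} (hx : B.Nn x) (b : {x // x ∈ B.Pi}) : ∃ n : ℕ, B.co b x = n := by
  obtain ⟨cf, rfl⟩ := hx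
  exact ⟨_, B.co_sum cf b⟩

theorem Nn.co_nonneg {x : V} (hx : B.Nn x) (b : {x // x ∈ B.Pi}) : 0 ≤ B.co b x := by
  obtain ⟨n, hn⟩ := hx.exists_co b
  rw [hn]; positivity

variable (B)

/-- The height functional. -/
noncomputable def ht : V →ₗ[ℝ] ℝ := ∑ b, B.co b

theorem ht_simple {b : V} (hb : b ∈ B.Pi) : B.ht b = 1 := by
  rw [ht, LinearMap.sum_apply]
  exact (Finset.sum_congr rfl fun x _ => B.co_simple x ⟨b, hb⟩).trans (by simp)

variable {B}

theorem Nn.exists_ht {x : V} (hx : B.Nn x) : ∃ n : ℕ, B.ht x = n := by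
  choose f hf using hx.exists_co
  exact ⟨∑ b, f b, by simp [ht, hf]⟩

theorem Nn.ht_pos {x : V} (hx : B.Nn x) (h0 : x ≠ 0) : 1 ≤ B.ht x := by
  obtain ⟨n, hn⟩ := hx.exists_ht
  rcases Nat.eq_zero_or_pos n with rfl | hpos
  · refine absurd (B.ext_co fun b => ?_) h0
    rw [ht, LinearMap.sum_apply, Nat.cast_zero,
      Finset.sum_eq_zero_iff_of_nonneg fun b _ => hx.co_nonneg b] at hn
    rw [hn b (Finset.mem_univ b), map_zero]
  · rw [hn]; exact_mod_cast hpos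

variable (B)

theorem nn_pos {α : V} (hα : α ∈ B.Pos) : B.Nn α := B.decomp α hα

theorem one_le_ht {α : V} (hα : α ∈ B.Pos) : 1 ≤ B.ht α :=
  (B.nn_pos hα).ht_pos (S.ne_zero (B.pos_sub hα))

theorem pi_ne_zero {b : V} (hb : b ∈ B.Pi) : b ≠ 0 := S.ne_zero (B.pos_sub (B.pi_sub hb))

theorem pi_mem {b : V} (hb : b ∈ B.Pi) : b ∈ S.R := B.pos_sub (B.pi_sub hb)

theorem mem_pos_of_ht {α : V} (hα : α ∈ S.R) (h : 0 ≤ B.ht α) : α ∈ B.Pos := by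
  refine (B.mem_or_neg α hα).resolve_right fun h1 => ?_
  have := B.one_le_ht h1
  rw [map_neg] at this
  linarith

theorem exists_int_ht {α : V} (hα : α ∈ S.R) : ∃ n : ℤ, B.ht α = n := by
  rcases B.mem_or_neg α hα with h | h
  · obtain ⟨n, hn⟩ := (B.nn_pos h).exists_ht
    exact ⟨n, by simp [hn]⟩
  · obtain ⟨n, hn⟩ := (B.nn_pos h).exists_ht
    rw [map_neg] at hn
    exact ⟨-n, by push_cast; linarith⟩

theorem refl_pos {b α : V} (hb : b ∈ B.Pi) (hα : α ∈ B.Pos) (hne : α ≠ b) :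
    S.refl b α ∈ B.Pos := by
  refine (B.mem_or_neg _ (S.refl_mem (B.pi_mem hb) (B.pos_sub hα))).resolve_right fun h => ?_
  have h0 : ∀ b' : {x // x ∈ B.Pi}, b' ≠ ⟨b, hb⟩ → B.co b' α = 0 := by
    intro b' hb'
    have h1 := (B.nn_pos h).co_nonneg b'
    have h2 := (B.nn_pos hα).co_nonneg b'
    have h3 := B.co_simple b' ⟨b, hb⟩
    rw [if_neg hb'.symm] at h3
    simp only [S.refl_apply, map_neg, map_sub, map_smul, h3, smul_zero, sub_zero] at h1
    linarith
  have h1 : α = B.co ⟨b, hb⟩ α • b := by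
    conv_lhs => rw [← B.sum_co α]
    rw [Finset.sum_eq_single ⟨b, hb⟩ (fun b' _ hb' => by rw [h0 b' hb', zero_smul])
      fun h => absurd (Finset.mem_univ _) h]
  rcases S.reduced b (B.pi_mem hb) _ (h1 ▸ B.pos_sub hα) with h2 | h2
  · rw [h2, one_smul] at h1; exact hne h1
  · have := (B.nn_pos hα).co_nonneg ⟨b, hb⟩
    rw [h2] at this
    linarith

theorem sum_erase_refl {A : Type*} [AddCommMonoid A] {b : V} (hb : b ∈ B.Pi) (F : V → A) :
    ∑ α ∈ B.Pos.erase b, F (S.refl b α) = ∑ α ∈ B.Pos.erase b, F α := by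
  have h : ∀ α ∈ B.Pos.erase b, S.refl b α ∈ B.Pos.erase b := by
    intro α hα
    rw [Finset.mem_erase] at hα ⊢
    refine ⟨fun h => ?_, B.refl_pos hb hα.2 hα.1⟩
    have h1 : α = -b := by
      rw [← S.refl_refl b α, h, S.refl_self (B.pi_ne_zero hb)]
    exact B.not_both b (B.pi_sub hb) (h1 ▸ hα.2)
  exact Finset.sum_nbij' (S.refl b) (S.refl b) h h
    (fun _ _ => S.refl_refl _ _) (fun _ _ => S.refl_refl _ _) fun _ _ => rfl

theorem two_smul_weylVec : (2 : ℝ) • weylVec B = ∑ α ∈ B.Pos, α := by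
  rw [weylVec, smul_smul]; norm_num

theorem refl_weylVec {b : V} (hb : b ∈ B.Pi) : S.refl b (weylVec B) = weylVec B - b := by
  have h1 : S.refl b (∑ α ∈ B.Pos, α) = ∑ α ∈ B.Pos, α - (2 : ℝ) • b := by
    rw [map_sum, ← Finset.add_sum_erase _ _ (B.pi_sub hb),
      ← Finset.add_sum_erase _ (fun α => α) (B.pi_sub hb),
      B.sum_erase_refl hb fun α => α, S.refl_self (B.pi_ne_zero hb)]
    module
  rw [weylVec, map_smul, h1, smul_sub, smul_smul]
  norm_num

theorem pair_weylVec {b : V} (hb : b ∈ B.Pi) : S.pair b (weylVec B) = 1 := by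
  have h := B.refl_weylVec hb
  rw [S.refl_apply, sub_right_inj] at h
  have h1 : (S.pair b (weylVec B) - 1) • b = 0 := by rw [sub_smul, h, one_smul, sub_self]
  have := (smul_eq_zero.mp h1).resolve_right (B.pi_ne_zero hb)
  linarith

theorem form_weylVec {b : V} (hb : b ∈ B.Pi) : S.I (weylVec B) b = S.I b b / 2 := by
  have h := S.pair_mul (B.pi_ne_zero hb) (weylVec B)
  rw [B.pair_weylVec hb] at h
  rw [S.symm]
  linarith

theorem form_eq_sum (x y : V) : S.I x y = ∑ b, B.co b y * S.I x (b : V) := by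
  conv_lhs => rw [← B.sum_co y]
  simp

theorem form_weylVec_pos {α : V} (hα : α ∈ B.Pos) : 0 < S.I (weylVec B) α := by
  rw [B.form_eq_sum]
  have h0 : ∀ b ∈ (Finset.univ : Finset {x // x ∈ B.Pi}),
      0 ≤ B.co b α * S.I (weylVec B) (b : V) := by
    intro b _
    rw [B.form_weylVec b.2]
    exact mul_nonneg ((B.nn_pos hα).co_nonneg b) (by have := S.form_self_nonneg b; positivity)
  refine lt_of_le_of_ne (Finset.sum_nonneg h0) fun h => ?_
  rw [eq_comm, Finset.sum_eq_zero_iff_of_nonneg h0] at h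
  refine S.ne_zero (B.pos_sub hα) (B.ext_co fun b => ?_)
  have h1 := h b (Finset.mem_univ _)
  rw [B.form_weylVec b.2] at h1
  rw [map_zero]
  exact (mul_eq_zero.mp h1).resolve_right (by have := S.form_pos (B.pi_mem b.2); positivity)

theorem mem_pos_of_form {α : V} (hα : α ∈ S.R) (h : 0 < S.I (weylVec B) α) : α ∈ B.Pos := by
  refine (B.mem_or_neg α hα).resolve_right fun h1 => ?_
  have := B.form_weylVec_pos h1
  rw [map_neg] at this
  linarith

theorem sum_roots {A : Type*} [AddCommMonoid A] (F : V → A) :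
    ∑ α ∈ S.R, F α = ∑ α ∈ B.Pos, (F α + F (-α)) := by
  have h : S.R = B.Pos ∪ B.Pos.image fun α => -α := by
    ext α
    simp only [Finset.mem_union, Finset.mem_image]
    constructor
    · intro hα
      exact (B.mem_or_neg α hα).imp id fun h => ⟨-α, h, neg_neg α⟩
    · rintro (hα | ⟨β, hβ, rfl⟩)
      · exact B.pos_sub hα
      · exact S.neg_mem (B.pos_sub hβ)
  rw [h, Finset.sum_union, Finset.sum_image fun _ _ _ _ h => neg_injective h,
    Finset.sum_add_distrib]
  rw [Finset.disjoint_left]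
  intro α hα h1
  obtain ⟨β, hβ, rfl⟩ := Finset.mem_image.mp h1
  exact B.not_both β hβ hα

/-- The root `θ` is the highest root. -/
structure Highest (θ : V) : Prop where
  mem : θ ∈ S.R
  nn : ∀ α ∈ S.R, B.Nn (θ - α)

namespace Highest

variable {B} {θ : V}

theorem ne_zero (H : B.Highest θ) : θ ≠ 0 := S.ne_zero H.mem

theorem mem_pos (H : B.Highest θ) : θ ∈ B.Pos := by
  refine B.mem_pos_of_ht H.mem ?_
  obtain ⟨n, hn⟩ := (H.nn _ (S.neg_mem H.mem)).exists_ht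
  rw [map_sub, map_neg] at hn
  have : (0 : ℝ) ≤ n := n.cast_nonneg
  linarith

theorem pair_simple_nonneg (H : B.Highest θ) {b : V} (hb : b ∈ B.Pi) : 0 ≤ S.pair b θ := by
  have h := (H.nn _ (S.refl_mem (B.pi_mem hb) H.mem)).co_nonneg ⟨b, hb⟩
  rw [S.refl_apply, sub_sub_cancel, map_smul] at h
  have h1 := B.co_simple ⟨b, hb⟩ ⟨b, hb⟩
  rw [if_pos rfl] at h1
  change B.co ⟨b, hb⟩ b = 1 at h1
  rwa [h1, smul_eq_mul, mul_one] at h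

theorem form_simple_nonneg (H : B.Highest θ) {b : V} (hb : b ∈ B.Pi) : 0 ≤ S.I θ b := by
  have h := S.pair_mul (B.pi_ne_zero hb) θ
  rw [S.symm]
  have := mul_nonneg (H.pair_simple_nonneg hb) (S.form_self_nonneg b)
  linarith

theorem form_nonneg (H : B.Highest θ) {α : V} (hα : α ∈ B.Pos) : 0 ≤ S.I θ α := by
  rw [B.form_eq_sum]
  exact Finset.sum_nonneg fun b _ =>
    mul_nonneg ((B.nn_pos hα).co_nonneg b) (H.form_simple_nonneg b.2)

theorem neg_one_le_pair (H : B.Highest θ) {α : V} (hα : α ∈ S.R) (hne : α ≠ -θ) :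
    -1 ≤ S.pair θ α := by
  obtain ⟨k, hk⟩ := S.pair_int H.mem hα
  by_contra! hlt
  have hk2 : (2 : ℝ) ≤ -k := by
    rw [hk] at hlt
    have : k < -1 := by exact_mod_cast hlt
    exact_mod_cast (by omega : (2 : ℤ) ≤ -k)
  refine hne (B.ext_co fun b => ?_)
  have h1 := (H.nn _ (S.refl_mem H.mem hα)).co_nonneg b
  have h2 := (H.nn _ (S.neg_mem hα)).co_nonneg b
  have h3 := (B.nn_pos H.mem_pos).co_nonneg b
  simp only [S.refl_apply, map_sub, map_neg, map_smul, smul_eq_mul, hk] at h1 h2 ⊢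
  nlinarith

theorem pair_pos (H : B.Highest θ) {α : V} (hα : α ∈ B.Pos) (hne : α ≠ θ) :
    S.pair θ α = 0 ∨ S.pair θ α = 1 := by
  obtain ⟨k, hk⟩ := S.pair_int H.mem (B.pos_sub hα)
  have h1 : 0 ≤ S.pair θ α := by
    rw [S.pair_apply]
    have := H.form_nonneg hα
    have := S.form_self_nonneg θ
    positivity
  have h2 := H.neg_one_le_pair (S.neg_mem (B.pos_sub hα)) fun h => hne (neg_injective h)
  rw [map_neg] at h2
  rw [hk] at h1 h2 ⊢
  have h3 : 0 ≤ k := by exact_mod_cast h1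
  have h4 : k ≤ 1 := by exact_mod_cast (by linarith : (k : ℝ) ≤ 1)
  norm_cast
  omega

end Highest

/-- The dual Coxeter number scaled by half the square length of `θ`. -/
noncomputable def level (B : Base S) (θ : V) : ℝ := S.I θ θ / 2 + S.I (weylVec B) θ

namespace Highest

variable {B} {θ : V}

theorem level_pos (H : B.Highest θ) : 0 < B.level θ := by
  have h1 := S.form_pos H.mem
  have h2 := B.form_weylVec_pos H.mem_pos
  rw [level]; linarith

theorem casimir_eq (H : B.Highest θ) (x : V) : S.casimir x = (2 * B.level θ) • x := by
  obtain ⟨κ, hκ⟩ := S.exists_casimir_eq H.mem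
  rw [hκ]
  congr 1
  have h1 := S.form_casimir θ θ
  rw [hκ, map_smul, LinearMap.smul_apply, smul_eq_mul, B.sum_roots] at h1
  have hN := S.form_pos H.mem
  have h2 : ∀ α ∈ B.Pos, S.I α θ * S.I α θ + S.I (-α) θ * S.I (-α) θ =
      S.I θ θ * S.I α θ + if α = θ then S.I θ θ * S.I θ θ else 0 := by
    intro α hα
    have h3 := S.pair_mul H.ne_zero α
    rw [S.symm θ α] at h3
    simp only [map_neg, LinearMap.neg_apply]
    split_ifs with h
    · subst h; ring
    · rcases H.pair_pos hα h with h4 | h4 <;> rw [h4] at h3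
      · have : S.I α θ = 0 := by linarith
        rw [this]; ring
      · have : S.I θ θ = 2 * S.I α θ := by linarith
        rw [this]; ring
  rw [Finset.sum_congr rfl h2, Finset.sum_add_distrib, Finset.sum_ite_eq', if_pos H.mem_pos,
    ← Finset.mul_sum] at h1
  have h3 : ∑ α ∈ B.Pos, S.I α θ = 2 * S.I (weylVec B) θ := by
    rw [← smul_eq_mul, ← LinearMap.smul_apply, ← map_smul, B.two_smul_weylVec, map_sum,
      LinearMap.sum_apply]
  rw [h3] at h1
  rw [level]
  exact mul_right_cancel₀ hN.ne' (by linarith)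

theorem sum_form_mul (H : B.Highest θ) (x y : V) :
    ∑ α ∈ S.R, S.I α x * S.I α y = 2 * B.level θ * S.I x y := by
  rw [← S.form_casimir, H.casimir_eq, map_smul, LinearMap.smul_apply, smul_eq_mul]

theorem sum_pos_form_mul (H : B.Highest θ) (x y : V) :
    ∑ α ∈ B.Pos, S.I α x * S.I α y = B.level θ * S.I x y := by
  have h := H.sum_form_mul x y
  rw [B.sum_roots] at h
  have h1 : ∀ α ∈ B.Pos, S.I α x * S.I α y + S.I (-α) x * S.I (-α) y =
      2 * (S.I α x * S.I α y) := by
    intro α _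
    simp only [map_neg, LinearMap.neg_apply]
    ring
  rw [Finset.sum_congr rfl h1, ← Finset.mul_sum] at h
  linarith

theorem sum_form_self (H : B.Highest θ) [FiniteDimensional ℝ V] :
    ∑ α ∈ S.R, S.I α α = 2 * B.level θ * Module.finrank ℝ V := by
  have h1 : S.casimir = (2 * B.level θ) • (LinearMap.id : V →ₗ[ℝ] V) :=
    LinearMap.ext H.casimir_eq
  have h2 := congrArg (LinearMap.trace ℝ V) h1
  rw [RootSys.casimir, map_sum, map_smul, LinearMap.trace_id, smul_eq_mul] at h2
  rw [← h2]
  refine Finset.sum_congr rfl fun α _ => ?_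
  rw [LinearMap.trace_smulRight]

theorem level_mul_pair_int (H : B.Highest θ) {β α : V} (hβ : β ∈ corootLat S) (hα : α ∈ S.R) :
    ∃ n : ℤ, S.pair α (B.level θ • β) = n := by
  have h : ∀ γ : V, ∃ n : ℤ, γ ∈ B.Pos → S.I γ β * S.pair α γ = n := by
    intro γ
    by_cases hγ : γ ∈ B.Pos
    · obtain ⟨m, hm⟩ := S.corootLat_int hβ (B.pos_sub hγ)
      obtain ⟨n, hn⟩ := S.pair_int hα (B.pos_sub hγ)
      exact ⟨m * n, fun _ => by rw [hm, hn]; push_cast; ring⟩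
    · exact ⟨0, fun h => absurd h hγ⟩
  choose f hf using h
  refine ⟨∑ γ ∈ B.Pos, f γ, ?_⟩
  push_cast
  rw [← Finset.sum_congr rfl hf, S.pair_apply, map_smul, smul_eq_mul, S.symm α β,
    ← H.sum_pos_form_mul, Finset.mul_sum]
  refine Finset.sum_congr rfl fun γ _ => ?_
  rw [S.pair_apply, S.symm α γ]
  ring

end Highest

end Base

namespace RootSys

variable {V : Type} [AddCommGroup V] [Module ℝ V] (S : RootSys V)

theorem refl_conj {u : V ≃ₗ[ℝ] V} (hu : ∀ x y, S.I (u x) (u y) = S.I x y) (α : V) :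
    S.refl (u α) * u = u * S.refl α := by
  ext x
  rw [LinearEquiv.mul_apply, LinearEquiv.mul_apply, refl_apply, refl_apply, pair_apply,
    pair_apply, map_sub, map_smul, hu, hu]

theorem form_sq_le (x y : V) : S.I x y * S.I x y ≤ S.I x x * S.I y y := by
  rcases eq_or_ne x 0 with rfl | hx
  · simp
  have h := S.form_self_nonneg (S.I x x • y - S.I x y • x)
  simp only [map_sub, map_smul, LinearMap.sub_apply, LinearMap.smul_apply, smul_eq_mul] at h
  rw [S.symm y x] at h
  have hx := S.posdef x hx
  have h1 : 0 ≤ S.I x x * (S.I x x * S.I y y - S.I x y * S.I x y) := by linarith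
  have := nonneg_of_mul_nonneg_right h1 hx
  linarith

end RootSys

namespace Base

variable {V : Type} [AddCommGroup V] [Module ℝ V] {S : RootSys V} (B : Base S)

theorem finite_lattice {S : RootSys V} (B : Base S) (N : ℝ) :
    {x : V | (∀ α ∈ S.R, ∃ n : ℤ, S.pair α x = n) ∧ S.I x x ≤ N}.Finite := by
  have hfin : ∀ b : {x // x ∈ B.Pi},
      {r : ℝ | (∃ n : ℤ, r = n) ∧ |r| ≤ 1 + 4 * N / S.I (b : V) b}.Finite := by
    intro b
    set K := 1 + 4 * N / S.I (b : V) b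
    refine ((Set.finite_Icc (-⌈K⌉) ⌈K⌉).image fun n : ℤ => (n : ℝ)).subset ?_
    rintro r ⟨⟨n, rfl⟩, hr⟩
    have h := (abs_le.mp hr)
    have h1 := Int.le_ceil K
    refine ⟨n, ⟨?_, ?_⟩, rfl⟩
    · exact_mod_cast (by push_cast; linarith : ((-⌈K⌉ : ℤ) : ℝ) ≤ n)
    · exact_mod_cast (by linarith : (n : ℝ) ≤ ⌈K⌉)
  refine Set.Finite.of_finite_image (f := fun x => fun b : {x // x ∈ B.Pi} => S.pair (b : V) x)
    ((Set.Finite.pi' hfin).subset ?_) ?_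
  · rintro _ ⟨x, ⟨hx, hN⟩, rfl⟩ b
    refine ⟨hx b (B.pi_mem b.2), ?_⟩
    have h1 := S.form_pos (B.pi_mem b.2)
    have h2 := S.form_sq_le (b : V) x
    have h3 := S.pair_mul (B.pi_ne_zero b.2) x
    have h4 : S.pair (b : V) x ^ 2 ≤ 4 * N / S.I (b : V) b := by
      rw [le_div_iff₀ h1]
      refine le_of_mul_le_mul_right ?_ h1
      have : S.pair (b : V) x ^ 2 * S.I (b : V) b * S.I (b : V) b =
          4 * (S.I (b : V) x * S.I (b : V) x) := by
        linear_combination (S.pair (b : V) x * S.I (b : V) b + 2 * S.I (b : V) x) * h3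
      rw [this]
      nlinarith
    refine le_trans ?_ (add_le_add_right h4 1)
    nlinarith [sq_abs (S.pair (b : V) x), sq_nonneg (|S.pair (b : V) x| - 1)]
  · intro x _ y _ h
    have h1 : ∀ b : {x // x ∈ B.Pi}, S.I (x - y) (b : V) = 0 := by
      intro b
      have h2 := congrFun h b
      have h3 := S.pair_mul (B.pi_ne_zero b.2) (x - y)
      simp only at h2
      rw [map_sub, h2, sub_self, zero_mul] at h3
      rw [S.symm]
      linarith
    have h2 : S.I (x - y) (x - y) = 0 := by
      rw [B.form_eq_sum]
      exact Finset.sum_eq_zero fun b _ => by rw [h1, mul_zero]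
    by_contra hne
    exact (S.posdef _ (sub_ne_zero.mpr hne)).ne' h2

/-- Every reflection in a positive root is a product of simple reflections. -/
theorem refl_mem_closure (n : ℕ) : ∀ α ∈ B.Pos, B.ht α ≤ n →
    S.refl α ∈ Subgroup.closure {u | ∃ b ∈ B.Pi, u = S.refl b} := by
  induction n with
  | zero =>
    intro α hα h
    have := B.one_le_ht hα
    norm_num at h; linarith
  | succ n ih =>
    intro α hα hn
    by_cases hPi : α ∈ B.Pi
    · exact Subgroup.subset_closure ⟨α, hPi, rfl⟩
    obtain ⟨b, hb⟩ : ∃ b : {x // x ∈ B.Pi}, 0 < S.I α (b : V) := by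
      by_contra! H
      have h1 := S.form_pos (B.pos_sub hα)
      rw [B.form_eq_sum] at h1
      exact h1.not_ge (Finset.sum_nonpos fun b _ =>
        mul_nonpos_of_nonneg_of_nonpos ((B.nn_pos hα).co_nonneg b) (H b))
    have hs : S.refl (b : V) ∈ Subgroup.closure {u | ∃ b ∈ B.Pi, u = S.refl b} :=
      Subgroup.subset_closure ⟨b, b.2, rfl⟩
    have h1 := B.refl_pos b.2 hα fun h => hPi (h ▸ b.2)
    have h2 : 1 ≤ S.pair (b : V) α := by
      obtain ⟨k, hk⟩ := S.pair_int (B.pi_mem b.2) (B.pos_sub hα)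
      have h3 : 0 < S.pair (b : V) α := by
        rw [S.pair_apply, S.symm (b : V) α]
        have := S.form_pos (B.pi_mem b.2)
        positivity
      rw [hk] at h3 ⊢
      exact_mod_cast h3
    have h3 := ih _ h1 (by
      rw [S.refl_apply, map_sub, map_smul, B.ht_simple b.2, smul_eq_mul, mul_one]
      push_cast at hn
      linarith)
    have h4 := S.refl_conj (S.form_refl (b : V)) α
    have h5 : S.refl α = S.refl (b : V) * (S.refl (S.refl (b : V) α) * S.refl (b : V)) := by
      rw [h4, ← mul_assoc, S.refl_mul_self, one_mul]
    rw [h5]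
    exact mul_mem hs (mul_mem h3 hs)

/-- The product of the simple reflections along a word. -/
noncomputable def word (L : List {x // x ∈ B.Pi}) : V ≃ₗ[ℝ] V :=
  (L.map fun b => S.refl (b : V)).prod

theorem word_cons (b : {x // x ∈ B.Pi}) (L : List {x // x ∈ B.Pi}) :
    B.word (b :: L) = S.refl (b : V) * B.word L := by simp [word]

theorem form_word (L : List {x // x ∈ B.Pi}) (x y : V) :
    S.I (B.word L x) (B.word L y) = S.I x y := by
  induction L with
  | nil => simp [word]
  | cons b L ih => rw [word_cons, LinearEquiv.mul_apply, LinearEquiv.mul_apply, S.form_refl, ih]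

theorem exists_word {u : V ≃ₗ[ℝ] V} (hu : u ∈ Weyl S) : ∃ L, u = B.word L := by
  have h1 : u ∈ Subgroup.closure {u | ∃ b ∈ B.Pi, u = S.refl b} := by
    rw [S.weyl_eq_closure] at hu
    refine (Subgroup.closure_le _).mpr ?_ hu
    rintro _ ⟨α, hα, rfl⟩
    rcases B.mem_or_neg α hα with h | h
    · obtain ⟨n, hn⟩ := exists_nat_ge (B.ht α)
      exact B.refl_mem_closure n α h hn
    · obtain ⟨n, hn⟩ := exists_nat_ge (B.ht (-α))
      have h2 := B.refl_mem_closure n _ h hn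
      have h3 : S.refl (-α) = S.refl α := by
        ext x; simp [S.refl_apply, S.pair_apply]
      rwa [h3] at h2
  induction h1 using Subgroup.closure_induction_left with
  | one => exact ⟨[], rfl⟩
  | mul_left x hx y _ ih =>
    obtain ⟨b, hb, rfl⟩ := hx
    obtain ⟨L, rfl⟩ := ih (by
      have := mul_mem (S.refl_mem_weyl (B.pi_mem hb)) hu
      rwa [← mul_assoc, S.refl_mul_self, one_mul] at this)
    exact ⟨⟨b, hb⟩ :: L, by rw [word_cons]⟩
  | inv_mul_cancel x hx y _ ih =>
    obtain ⟨b, hb, rfl⟩ := hx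
    rw [inv_eq_of_mul_eq_one_left (S.refl_mul_self b)] at hu ⊢
    obtain ⟨L, rfl⟩ := ih (by
      have := mul_mem (S.refl_mem_weyl (B.pi_mem hb)) hu
      rwa [← mul_assoc, S.refl_mul_self, one_mul] at this)
    exact ⟨⟨b, hb⟩ :: L, by rw [word_cons]⟩

/-- The deletion property. -/
theorem exists_shorter_word (α : {x // x ∈ B.Pi}) (L : List {x // x ∈ B.Pi})
    (h : B.word L α ∉ B.Pos) :
    ∃ L' : List {x // x ∈ B.Pi}, L'.length + 1 = L.length ∧
      B.word L * S.refl (α : V) = B.word L' := by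
  induction L with
  | nil => exact absurd (B.pi_sub α.2) h
  | cons b L ih =>
    rw [word_cons] at h ⊢
    by_cases h1 : B.word L α ∈ B.Pos
    · have h2 : B.word L α = b := by
        by_contra hne
        exact h (B.refl_pos b.2 h1 hne)
      refine ⟨L, rfl, ?_⟩
      rw [mul_assoc, ← S.refl_conj (B.form_word L), h2, ← mul_assoc, S.refl_mul_self, one_mul]
    · obtain ⟨L', hL, hw⟩ := ih h1
      exact ⟨b :: L', by simp [hL], by rw [word_cons, mul_assoc, hw]⟩

theorem word_eq_one (n : ℕ) : ∀ L : List {x // x ∈ B.Pi}, L.length ≤ n →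
    (∀ α ∈ B.Pos, B.word L α ∈ B.Pos) → B.word L = 1 := by
  induction n with
  | zero => intro L hL _; rw [List.length_eq_zero_iff.mp (Nat.le_zero.mp hL)]; rfl
  | succ n ih =>
    intro L hL h
    rcases List.eq_nil_or_concat L with rfl | ⟨L, α, rfl⟩
    · rfl
    have h1 : B.word (L.concat α) = B.word L * S.refl (α : V) := by simp [word]
    obtain ⟨L', hL', hw⟩ := B.exists_shorter_word α L fun hpos => by
      have h2 := h α (B.pi_sub α.2)
      rw [h1, LinearEquiv.mul_apply, S.refl_self (B.pi_ne_zero α.2), map_neg] at h2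
      exact B.not_both _ hpos h2
    rw [h1, hw] at h ⊢
    refine ih L' ?_ h
    simp at hL
    omega

theorem eq_one_of_fix_weylVec {u : V ≃ₗ[ℝ] V} (hu : u ∈ Weyl S)
    (h : u (weylVec B) = weylVec B) : u = 1 := by
  obtain ⟨L, rfl⟩ := B.exists_word hu
  refine B.word_eq_one _ L le_rfl fun α hα => ?_
  refine B.mem_pos_of_form (S.weyl_mem hu (B.pos_sub hα)) ?_
  rw [← h, S.form_weyl hu]
  exact B.form_weylVec_pos hα

theorem Highest.eq_one_of_translate {B : Base S} {θ : V} (H : B.Highest θ) {u : V ≃ₗ[ℝ] V}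
    (hu : u ∈ Weyl S) {β : V} (hβ : β ∈ corootLat S)
    (h : weylVec B - u (weylVec B) = B.level θ • β) : u = 1 := by
  have hc := H.level_pos
  have h1 : u (weylVec B) = weylVec B - B.level θ • β := by rw [← h]; abel
  have h2 := S.form_weyl hu (weylVec B) (weylVec B)
  rw [h1] at h2
  simp only [map_sub, map_smul, LinearMap.sub_apply, LinearMap.smul_apply, smul_eq_mul] at h2
  rw [S.symm β (weylVec B)] at h2
  have h3 : B.level θ * S.I β β = 2 * S.I (weylVec B) β :=
    mul_left_cancel₀ hc.ne' (by linarith)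
  have h4 : ∑ α ∈ B.Pos, S.I α β = 2 * S.I (weylVec B) β := by
    rw [← smul_eq_mul, ← LinearMap.smul_apply, ← map_smul, B.two_smul_weylVec, map_sum,
      LinearMap.sum_apply]
  rw [← H.sum_pos_form_mul, ← h4, ← sub_eq_zero, ← Finset.sum_sub_distrib,
    Finset.sum_eq_zero_iff_of_nonneg] at h3
  · have h5 : ∀ α ∈ B.Pos, |S.I α β| ≤ 1 := by
      intro α hα
      have h6 : S.I α β * (S.I α β - 1) = 0 := by linarith [h3 α hα]
      rcases mul_eq_zero.mp h6 with h7 | h7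
      · rw [h7]; simp
      · rw [sub_eq_zero.mp h7]; simp
    have h6 : β = 0 := by
      refine S.eq_zero_of_minuscule hβ fun α hα => ?_
      rcases B.mem_or_neg α hα with h7 | h7
      · exact h5 α h7
      · simpa using h5 _ h7
    rw [h6, smul_zero, sub_zero] at h1
    exact B.eq_one_of_fix_weylVec hu h1
  · intro α hα
    obtain ⟨n, hn⟩ := S.corootLat_int hβ (B.pos_sub hα)
    rw [hn]
    have : n ≤ n * n := Int.le_self_sq n |>.trans_eq (by ring)
    have : (n : ℝ) ≤ n * n := by exact_mod_cast this
    linarith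

end Base

namespace Base

variable {V : Type} [AddCommGroup V] [Module ℝ V] {S : RootSys V} (B : Base S)

/-- Positive real affine roots `α + nδ`. -/
abbrev RealIdx : Type :=
  {q : V × ℤ // q.1 ∈ S.R ∧ (0 < q.2 ∨ q.2 = 0 ∧ q.1 ∈ B.Pos)}

/-- Positive affine roots, the imaginary ones repeated according to their multiplicity. -/
abbrev AffIdx : Type := B.RealIdx ⊕ (ℕ × Fin (Module.finrank ℝ V))

/-- The positive affine root with a given index. -/
def affRoot : B.AffIdx → V × ℝ :=
  Sum.elim (fun q => (q.1.1, (q.1.2 : ℝ))) fun x => (0, (x.1 : ℝ) + 1)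

/-- The height of an element of the affine root lattice. -/
noncomputable def affHt (θ : V) : V × ℝ →ₗ[ℝ] ℝ :=
  B.ht ∘ₗ LinearMap.fst ℝ V ℝ + (1 + B.ht θ) • LinearMap.snd ℝ V ℝ

theorem affHt_apply (θ y : V) (k : ℝ) : B.affHt θ (y, k) = B.ht y + (1 + B.ht θ) * k := by
  simp [affHt]

variable {B} {θ : V}

theorem Highest.ht_add_nonneg (H : B.Highest θ) {α : V} (hα : α ∈ S.R) : 0 ≤ B.ht α + B.ht θ := by
  obtain ⟨n, hn⟩ := (H.nn _ (S.neg_mem hα)).exists_ht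
  rw [sub_neg_eq_add, map_add] at hn
  have : (0 : ℝ) ≤ n := n.cast_nonneg
  linarith

theorem Highest.graded (H : B.Highest θ) : Graded (B.affHt θ) B.affRoot := by
  have hθ := B.one_le_ht H.mem_pos
  refine ⟨?_, fun N => ?_⟩
  · rintro (⟨⟨α, n⟩, hα, hn⟩ | ⟨n, i⟩)
    · simp only [affRoot, Sum.elim_inl, affHt_apply]
      simp only at hα hn
      rcases hn with hn | ⟨rfl, hn⟩
      · have h1 : (1 : ℝ) ≤ n := by exact_mod_cast hn
        have h2 := H.ht_add_nonneg hα
        nlinarith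
      · have := B.one_le_ht hn
        simpa using this
    · simp only [affRoot, Sum.elim_inr, affHt_apply, map_zero]
      have : (0 : ℝ) ≤ n := n.cast_nonneg
      nlinarith
  · obtain ⟨K, hK⟩ := exists_nat_gt (N + B.ht θ)
    have h1 : {q : B.RealIdx | q.1 ∈ (S.R ×ˢ Finset.Icc (0 : ℤ) K : Finset (V × ℤ))}.Finite :=
      Set.Finite.preimage Subtype.val_injective.injOn (Finset.finite_toSet _)
    refine ((h1.image Sum.inl).union
      (((Set.finite_Iio K).prod (Set.finite_univ (α := Fin (Module.finrank ℝ V)))).image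
        Sum.inr)).subset ?_
    rintro (⟨⟨α, n⟩, hα, hn⟩ | ⟨n, i⟩) hj
    · refine Or.inl ⟨_, ?_, rfl⟩
      simp only [affRoot, Sum.elim_inl, affHt_apply, Set.mem_ofPred_eq] at hj
      simp only at hα hn
      have h0 : 0 ≤ n := by omega
      have h0' : (0 : ℝ) ≤ n := by exact_mod_cast h0
      have h2 := H.ht_add_nonneg hα
      have h3 : (n : ℝ) < (K : ℤ) := by push_cast; nlinarith
      have h4 : n < K := by exact_mod_cast h3
      simp only [Set.mem_ofPred_eq, Finset.mem_product, Finset.mem_Icc]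
      exact ⟨hα, h0, h4.le⟩
    · refine Or.inr ⟨_, ⟨?_, Set.mem_univ _⟩, rfl⟩
      simp only [affRoot, Sum.elim_inr, affHt_apply, map_zero, Set.mem_ofPred_eq] at hj
      have h0 : (0 : ℝ) ≤ n := n.cast_nonneg
      have h3 : (n : ℝ) < K := by nlinarith
      exact_mod_cast h3


variable (B)

/-- `β + eδ` is a simple affine root. -/
def IsSimple (θ β : V) (e : ℤ) : Prop := (β ∈ B.Pi ∧ e = 0) ∨ (β = -θ ∧ e = 1)

variable {B}

namespace IsSimple

variable {β : V} {e : ℤ}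

theorem mem (h : B.IsSimple θ β e) (H : B.Highest θ) : β ∈ S.R := by
  rcases h with ⟨h, -⟩ | ⟨rfl, -⟩
  · exact B.pi_mem h
  · exact S.neg_mem H.mem

theorem pos (h : B.IsSimple θ β e) : 0 < e ∨ e = 0 ∧ β ∈ B.Pos := by
  rcases h with ⟨h, rfl⟩ | ⟨rfl, rfl⟩
  · exact Or.inr ⟨rfl, B.pi_sub h⟩
  · exact Or.inl one_pos

theorem affHt_eq (h : B.IsSimple θ β e) : B.affHt θ (β, e) = 1 := by
  rw [affHt_apply]
  rcases h with ⟨h, rfl⟩ | ⟨rfl, rfl⟩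
  · simp [B.ht_simple h]
  · simp

theorem norm_eq (h : B.IsSimple θ β e) : S.I β β = 2 * S.I (weylVec B) β + 2 * B.level θ * e := by
  rcases h with ⟨h, rfl⟩ | ⟨rfl, rfl⟩
  · rw [B.form_weylVec h]; simp; ring
  · simp [level]; ring

/-- The simple affine reflections permute the other positive affine roots. -/
theorem refl_pos (h : B.IsSimple θ β e) (H : B.Highest θ) {α : V} {n m : ℤ}
    (hα : α ∈ S.R) (hn : 0 < n ∨ n = 0 ∧ α ∈ B.Pos)
    (hne : (α, n) ≠ (β, e)) (hm : S.pair β α = m) :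
    0 < n - m * e ∨ n - m * e = 0 ∧ S.refl β α ∈ B.Pos := by
  rcases h with ⟨h, rfl⟩ | ⟨rfl, rfl⟩
  · rw [mul_zero, sub_zero]
    refine hn.imp id fun ⟨h1, h2⟩ => ⟨h1, B.refl_pos h h2 fun h3 => hne (by rw [h1, h3])⟩
  · have hm' : S.pair θ α = -m := by
      rw [← hm, S.pair_apply, S.pair_apply]; simp
    have hrefl : S.refl (-θ) α = α + (m : ℝ) • θ := by
      rw [S.refl_apply, hm]; module
    rw [mul_one, hrefl]
    rcases eq_or_ne α (-θ) with rfl | hαθ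
    · rw [map_neg, S.pair_self H.ne_zero] at hm'
      have hm2 : m = 2 := by exact_mod_cast (by linarith : (m : ℝ) = 2)
      subst hm2
      have h1 : n ≠ 1 := fun h1 => hne (by rw [h1])
      have h2 : 0 < n := hn.resolve_right fun h2 => B.not_both θ H.mem_pos h2.2
      rcases eq_or_ne n 2 with rfl | h3
      · right
        refine ⟨rfl, ?_⟩
        have : -θ + ((2 : ℤ) : ℝ) • θ = θ := by push_cast; module
        rw [this]; exact H.mem_pos
      · left; omega
    · have h1 := H.neg_one_le_pair hα hαθ
      rw [hm'] at h1
      have h2 : m ≤ 1 := by exact_mod_cast (by linarith : (m : ℝ) ≤ 1)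
      rcases hn with hn | ⟨rfl, hn⟩
      · by_cases h3 : n = 1 ∧ m = 1
        · obtain ⟨rfl, rfl⟩ := h3
          right
          refine ⟨rfl, B.mem_pos_of_ht ?_ ?_⟩
          · rw [← hrefl]; exact S.refl_mem (S.neg_mem H.mem) hα
          · have := H.ht_add_nonneg hα
            simpa using this
        · left; omega
      · have h3 : 0 ≤ S.pair θ α := by
          rw [S.pair_apply]
          have := H.form_nonneg hn
          have := S.form_self_nonneg θ
          positivity
        rw [hm'] at h3
        have h4 : m ≤ 0 := by exact_mod_cast (by linarith : (m : ℝ) ≤ 0)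
        rcases eq_or_ne m 0 with rfl | h5
        · right; simpa using hn
        · left; omega

end IsSimple

/-- The linear reflection in the real affine root `β + eδ`. -/
noncomputable def affRefl (S : RootSys V) (β : V) (e : ℤ) : V × ℝ →ₗ[ℝ] V × ℝ :=
  LinearMap.id - (S.pair β ∘ₗ LinearMap.fst ℝ V ℝ).smulRight (β, (e : ℝ))

theorem affRefl_apply (S : RootSys V) (β : V) (e : ℤ) (y : V) (k : ℝ) :
    affRefl S β e (y, k) = (S.refl β y, k - S.pair β y * e) := by
  simp [affRefl, S.refl_apply]

/-- The action of a reflection on indices of real affine roots. -/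
noncomputable def idxRefl (S : RootSys V) (β : V) (e : ℤ) (q : V × ℤ) : V × ℤ :=
  (S.refl β q.1, q.2 - ⌊S.pair β q.1⌋ * e)

theorem pair_refl (S : RootSys V) {β : V} (hβ : β ∈ S.R) (α : V) :
    S.pair β (S.refl β α) = -S.pair β α := by
  rw [S.refl_apply, map_sub, map_smul, S.pair_self (S.ne_zero hβ), smul_eq_mul]; ring

theorem idxRefl_idxRefl {β : V} (e : ℤ) (hβ : β ∈ S.R) {q : V × ℤ} (hq : q.1 ∈ S.R) :
    idxRefl S β e (idxRefl S β e q) = q := by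
  obtain ⟨m, hm⟩ := S.pair_int hβ hq
  have h1 := pair_refl S hβ q.1
  rw [hm] at h1
  refine Prod.ext (S.refl_refl β q.1) ?_
  simp only [idxRefl, h1, hm]
  rw [← Int.cast_neg, Int.floor_intCast, Int.floor_intCast]
  ring

theorem affine_antisymm {β : V} {e : ℤ} (h : B.IsSimple θ β e) (H : B.Highest θ) (y : V) (k : ℝ) :
    prodCoeff B.affRoot (y + (1 - S.pair β y) • β, k + (1 - S.pair β y) * e) =
      -prodCoeff B.affRoot (y, k) := by
  have hβ := h.mem H
  set i : B.RealIdx := ⟨(β, e), hβ, h.pos⟩ with hi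
  have hfix : ∀ q : V × ℤ, q.1 ∈ S.R → idxRefl S β e q = (β, e) → q = (-β, -e) := by
    intro q hq h1
    rw [← idxRefl_idxRefl e hβ hq, h1]
    refine Prod.ext (S.refl_self (S.ne_zero hβ)) ?_
    simp only [idxRefl, S.pair_self (S.ne_zero hβ)]
    rw [show (2 : ℝ) = ((2 : ℤ) : ℝ) by norm_num, Int.floor_intCast]
    ring
  have hnot : ¬ (0 < -e ∨ -e = 0 ∧ -β ∈ B.Pos) := by
    rcases h.pos with h1 | ⟨rfl, h1⟩
    · rintro (h2 | h2) <;> omega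
    · rintro (h2 | h2)
      · simp at h2
      · exact B.not_both β h1 h2.2
  have hpos : ∀ q : B.RealIdx, q ≠ i → 0 < (idxRefl S β e q.1).2 ∨
      (idxRefl S β e q.1).2 = 0 ∧ (idxRefl S β e q.1).1 ∈ B.Pos := by
    intro q hq
    obtain ⟨m, hm⟩ := S.pair_int hβ q.2.1
    have := h.refl_pos H q.2.1 q.2.2 (fun h1 => hq (Subtype.ext h1)) hm
    simp only [idxRefl, hm, Int.floor_intCast]
    exact this
  set σ₀ : B.RealIdx → B.RealIdx := fun q => if hq : q = i then i else
    ⟨idxRefl S β e q.1, S.refl_mem hβ q.2.1, hpos q hq⟩ with hσ₀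
  have hσi : σ₀ i = i := by simp [hσ₀]
  have hσne : ∀ q, q ≠ i → (σ₀ q).1 = idxRefl S β e q.1 := by
    intro q hq; simp [hσ₀, hq]
  have hinv : Function.Involutive σ₀ := by
    intro q
    by_cases hq : q = i
    · rw [hq, hσi, hσi]
    · have h1 : σ₀ q ≠ i := by
        intro h1
        have h2 := hσne q hq
        rw [h1] at h2
        have h3 := hfix q.1 q.2.1 h2.symm
        have h4 := q.2.2
        rw [h3] at h4
        exact hnot h4
      refine Subtype.ext ?_
      rw [hσne _ h1, hσne _ hq, idxRefl_idxRefl e hβ q.2.1]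
  have key := H.graded.prodCoeff_antisymm (Sum.inl i : B.AffIdx) (affRefl S β e) ?_ ?_
    (Equiv.sumCongr hinv.toPerm (Equiv.refl _)) ?_ ?_ (y, k)
  · rw [← key, affRefl_apply]
    congr 1
    simp only [affRoot, Sum.elim_inl, hi, Prod.mk_add_mk, S.refl_apply]
    refine Prod.ext ?_ ?_
    · simp only; module
    · simp only; ring
  · rintro ⟨x, r⟩
    rw [affRefl_apply, affRefl_apply, S.refl_refl, pair_refl S hβ]
    refine Prod.ext rfl ?_
    simp only; ring
  · simp only [affRoot, Sum.elim_inl, hi, affRefl_apply]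
    rw [S.refl_self (S.ne_zero hβ), S.pair_self (S.ne_zero hβ)]
    refine Prod.ext rfl ?_
    simp only [Prod.snd_neg]; ring
  · simp [hσi]
  · rintro (q | x) hq
    · have hq' : q ≠ i := fun h1 => hq (by rw [h1])
      obtain ⟨m, hm⟩ := S.pair_int hβ q.2.1
      simp only [Equiv.sumCongr_apply, Sum.map_inl, Function.Involutive.coe_toPerm, affRoot,
        Sum.elim_inl, hσne q hq', affRefl_apply, idxRefl, hm, Int.floor_intCast]
      push_cast
      rfl
    · simp [affRoot, affRefl_apply]

end Base

namespace Base

variable {V : Type} [AddCommGroup V] [Module ℝ V] {S : RootSys V} (B : Base S) {θ : V}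

/-- The degenerate form on `V ⊕ ℝδ`. -/
noncomputable def affForm (S : RootSys V) : V × ℝ →ₗ[ℝ] V × ℝ →ₗ[ℝ] ℝ :=
  S.I.compl₁₂ (LinearMap.fst ℝ V ℝ) (LinearMap.fst ℝ V ℝ)

theorem affForm_apply (S : RootSys V) (p q : V × ℝ) : affForm S p q = S.I p.1 q.1 := by
  simp [affForm]

/-- The functional `x ↦ Î(ρ, x)` on `V ⊕ ℝδ`. -/
noncomputable def affRho (θ : V) : V × ℝ →ₗ[ℝ] ℝ :=
  S.I (weylVec B) ∘ₗ LinearMap.fst ℝ V ℝ + B.level θ • LinearMap.snd ℝ V ℝ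

theorem affRho_apply (θ : V) (p : V × ℝ) :
    B.affRho θ p = S.I (weylVec B) p.1 + B.level θ * p.2 := by
  simp [affRho]

/-- Zero for positive roots and one for negative roots. -/
noncomputable def sgnShift (α : V) : ℤ := if α ∈ B.Pos then 0 else 1

/-- Parametrization of the ways in which a multiple of `δ` arises from one or two
multiples of positive affine roots with nonvanishing Laplace coefficient. -/
abbrev DegIdx (S : RootSys V) : Type := Σ mn : ℕ × ℕ,
  Fin (Module.finrank ℝ V) ⊕ ({α : V // α ∈ S.R} × Fin (mn.2 + 1))

theorem sgnShift_pos (α : V) (s : ℕ) :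
    0 < s + B.sgnShift α ∨ s + B.sgnShift α = 0 ∧ α ∈ B.Pos := by
  unfold sgnShift
  split_ifs with h
  · rcases Nat.eq_zero_or_pos s with rfl | hs
    · exact Or.inr ⟨rfl, h⟩
    · left; omega
  · left; omega

theorem sgnShift_neg {α : V} (hα : α ∈ S.R) (s : ℕ) :
    0 < s + (1 - B.sgnShift α) ∨ s + (1 - B.sgnShift α) = 0 ∧ -α ∈ B.Pos := by
  unfold sgnShift
  split_ifs with h
  · left; omega
  · rcases Nat.eq_zero_or_pos s with rfl | hs
    · exact Or.inr ⟨rfl, (B.mem_or_neg α hα).resolve_left h⟩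
    · left; omega

/-- The positive affine real root with finite part `α` and level `s + sgnShift α`. -/
noncomputable def degLeft (α : {α : V // α ∈ S.R}) (s : ℕ) : B.RealIdx :=
  ⟨(α.1, s + B.sgnShift α.1), α.2, B.sgnShift_pos α.1 s⟩

/-- The positive affine real root with finite part `-α` and level `s + 1 - sgnShift α`. -/
noncomputable def degRight (α : {α : V // α ∈ S.R}) (s : ℕ) : B.RealIdx :=
  ⟨(-α.1, s + (1 - B.sgnShift α.1)), S.neg_mem α.2, B.sgnShift_neg α.2 s⟩

/-- The map from the parametrization to index data. -/
noncomputable def degMap : DegIdx S → (B.AffIdx × ℕ) ⊕ ((B.AffIdx × ℕ) × (B.AffIdx × ℕ))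
  | ⟨(m, n), Sum.inl i⟩ => Sum.inl (Sum.inr (n, i), m)
  | ⟨(m, n), Sum.inr (α, s)⟩ =>
      Sum.inr ((Sum.inl (B.degLeft α s), m), (Sum.inl (B.degRight α (n - s)), m))

theorem degMap_injective : Function.Injective B.degMap := by
  rintro ⟨⟨m, n⟩, i | ⟨α, s⟩⟩ ⟨⟨m', n'⟩, i' | ⟨α', s'⟩⟩ h
  · simp only [degMap, Sum.inl.injEq, Prod.mk.injEq, Sum.inr.injEq] at h
    obtain ⟨⟨rfl, rfl⟩, rfl⟩ := h
    rfl
  · simp [degMap] at h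
  · simp [degMap] at h
  · simp only [degMap, Sum.inl.injEq, Prod.mk.injEq, Sum.inr.injEq, degLeft, degRight,
      Subtype.mk.injEq] at h
    obtain ⟨⟨⟨h1, h2⟩, rfl⟩, ⟨-, h3⟩, -⟩ := h
    have hα : α = α' := Subtype.ext h1
    subst hα
    have hs := s.2
    have hs' := s'.2
    simp only at hs hs'
    have h4 : (s : ℕ) = s' := by omega
    have h5 : n = n' := by omega
    subst h5
    have h6 : s = s' := Fin.ext h4
    rw [h6]

variable {B}

theorem Highest.degree_sum [FiniteDimensional ℝ V] (H : B.Highest θ) (N : ℝ) :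
    (∑' x, if Graded.laplaceVec B.affRoot x = (0, N) then
      Graded.laplaceCoeff B.affRoot (affForm S) (B.affRho θ) x else 0) = 0 := by
  set F := fun x => if Graded.laplaceVec B.affRoot x = (0, N) then
      Graded.laplaceCoeff B.affRoot (affForm S) (B.affRho θ) x else 0 with hF
  have hsum : Summable F := by
    refine summable_of_hasFiniteSupport
      ((H.graded.graded_laplaceVec.finite (B.affHt θ (0, N))).subset fun x hx => ?_)
    by_contra hne
    refine hx (if_neg fun h => hne ?_)
    rw [Set.mem_ofPred_eq, h]
  have hF1 : ∀ m n i, F (B.degMap ⟨(m, n), Sum.inl i⟩) =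
      if ((m : ℝ) + 1) * (n + 1) = N then 2 * B.level θ * (n + 1) else 0 := by
    intro m n i
    simp only [hF, degMap, Graded.laplaceVec, Graded.laplaceCoeff, Sum.elim_inl, Graded.multiples,
      affRoot, Sum.elim_inr,
      affForm_apply, affRho_apply, Prod.smul_mk, smul_zero, map_zero, Prod.mk.injEq, true_and,
      smul_eq_mul]
    congr 1
    ring
  have hF2 : ∀ m n α s, F (B.degMap ⟨(m, n), Sum.inr (α, s)⟩) =
      if ((m : ℝ) + 1) * (n + 1) = N then -S.I α.1 α.1 else 0 := by
    intro m n α s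
    have hs : (s : ℕ) ≤ n := Nat.lt_succ_iff.mp s.2
    simp only [hF, degMap, Graded.laplaceVec, Graded.laplaceCoeff, Sum.elim_inl, Graded.multiples,
      affRoot, Sum.elim_inr,
      affForm_apply, Prod.smul_mk, degLeft, degRight, Prod.mk_add_mk, Prod.mk.injEq, map_neg,
      smul_eq_mul]
    have h1 : ((m : ℝ) + 1) • α.1 + ((m : ℝ) + 1) • -α.1 = 0 := by module
    have h2 : ((m : ℝ) + 1) * (((s : ℕ) + B.sgnShift α.1 : ℤ) : ℝ) +
        ((m : ℝ) + 1) * (((n - s : ℕ) + (1 - B.sgnShift α.1) : ℤ) : ℝ) =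
        ((m : ℝ) + 1) * (n + 1) := by
      push_cast [Nat.cast_sub hs]; ring
    rw [h1, h2]
    simp
  have hrange : Function.support F ⊆ Set.range B.degMap := by
    intro x hx
    have hvec : Graded.laplaceVec B.affRoot x = (0, N) := by
      by_contra h
      exact hx (if_neg h)
    have hco : Graded.laplaceCoeff B.affRoot (affForm S) (B.affRho θ) x ≠ 0 := by
      intro h
      exact hx (by simp [hF, h])
    rcases x with ⟨q | ⟨n, i⟩, m⟩ | ⟨⟨q | ⟨n, i⟩, m⟩, ⟨q' | ⟨n', i'⟩, m'⟩⟩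
    · exfalso
      simp only [Graded.laplaceVec, Sum.elim_inl, Graded.multiples, affRoot,
        Prod.smul_mk, Prod.mk.injEq] at hvec
      rcases smul_eq_zero.mp hvec.1 with h | h
      · have : (0 : ℝ) ≤ m := m.cast_nonneg
        linarith
      · exact S.ne_zero q.2.1 h
    · exact ⟨⟨(m, n), Sum.inl i⟩, rfl⟩
    · simp only [Graded.laplaceVec, Sum.elim_inl, Sum.elim_inr, Graded.multiples, affRoot,
        Prod.smul_mk,
        Prod.mk_add_mk, Prod.mk.injEq] at hvec
      have hm : (0 : ℝ) < (m : ℝ) + 1 := by positivity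
      have hm' : (0 : ℝ) < (m' : ℝ) + 1 := by positivity
      obtain ⟨⟨α, a⟩, hα, ha⟩ := q
      obtain ⟨⟨α', a'⟩, hα', ha'⟩ := q'
      simp only at hα ha hα' ha' hvec
      have h1 : α' = (-(((m : ℝ) + 1) / ((m' : ℝ) + 1))) • α := by
        have h2 : ((m' : ℝ) + 1) • α' = -(((m : ℝ) + 1) • α) := eq_neg_of_add_eq_zero_right hvec.1
        have h3 : α' = ((m' : ℝ) + 1)⁻¹ • ((m' : ℝ) + 1) • α' := by
          rw [smul_smul, inv_mul_cancel₀ hm'.ne', one_smul]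
        rw [h3, h2, smul_neg, smul_smul, neg_smul]
        congr 2; field_simp
      have h2 : (-(((m : ℝ) + 1) / ((m' : ℝ) + 1))) = -1 := by
        refine (S.reduced α hα _ (h1 ▸ hα')).resolve_left fun h => ?_
        have : 0 < ((m : ℝ) + 1) / ((m' : ℝ) + 1) := by positivity
        linarith
      rw [h2, neg_one_smul] at h1
      subst h1
      have h3 : m = m' := by
        rw [neg_inj, div_eq_one_iff_eq hm'.ne'] at h2
        exact_mod_cast add_right_cancel h2
      subst h3
      have hbound : B.sgnShift α ≤ a ∧ 1 - B.sgnShift α ≤ a' := by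
        unfold sgnShift
        split_ifs with hp
        · have := B.not_both α hp
          refine ⟨by omega, ?_⟩
          rcases ha' with h | h
          · omega
          · exact absurd h.2 this
        · refine ⟨?_, by omega⟩
          rcases ha with h | h
          · omega
          · exact absurd h.2 hp
      obtain ⟨s, hs⟩ := Int.eq_ofNat_of_zero_le (sub_nonneg.mpr hbound.1)
      obtain ⟨t, ht⟩ := Int.eq_ofNat_of_zero_le (sub_nonneg.mpr hbound.2)
      refine ⟨⟨(m, s + t), Sum.inr (⟨α, hα⟩, ⟨s, by simp only; omega⟩)⟩, ?_⟩
      simp only [degMap, degLeft, degRight, Sum.inr.injEq, Prod.mk.injEq, Sum.inl.injEq,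
        Subtype.mk.injEq, true_and, and_true]
      rw [Nat.add_sub_cancel_left]
      constructor <;> omega
    all_goals
      exfalso
      simp [Graded.laplaceCoeff, affRoot, affForm_apply] at hco
  rw [← B.degMap_injective.tsum_eq hrange]
  refine (Summable.tsum_sigma (hsum.comp_injective B.degMap_injective)).trans ?_
  refine (tsum_congr fun mn => ?_).trans tsum_zero
  obtain ⟨m, n⟩ := mn
  rw [tsum_fintype, Fintype.sum_sum_type, Fintype.sum_prod_type]
  simp only [Function.comp_apply, hF1, hF2]
  split_ifs
  · simp only [Finset.sum_const, Finset.card_univ, Fintype.card_fin, nsmul_eq_mul]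
    rw [← Finset.mul_sum, Finset.sum_neg_distrib,
      Finset.sum_coe_sort S.R (fun α => S.I α α), H.sum_form_self]
    push_cast
    ring
  · simp

end Base

namespace Base

variable {V : Type} [AddCommGroup V] [Module ℝ V] {S : RootSys V} {B : Base S} {θ : V}

/-- Antisymmetry under the dot action of the simple affine reflections. -/
def AffAntisymm (B : Base S) (θ : V) (d : V × ℝ → ℝ) : Prop :=
  ∀ β e, B.IsSimple θ β e → ∀ y k,
    d (y + (1 - S.pair β y) • β, k + (1 - S.pair β y) * e) = -d (y, k)

theorem Highest.eq_zero_of_dominant (H : B.Highest θ) {y : V}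
    (h : ∀ β e, B.IsSimple θ β e → S.pair β y ≤ 0) : y = 0 := by
  have h1 : ∀ β e, B.IsSimple θ β e → S.I y β ≤ 0 := by
    intro β e hβ
    have h2 := S.form_pos (hβ.mem H)
    have h3 := S.pair_mul (S.ne_zero (hβ.mem H)) y
    rw [S.symm y β]
    nlinarith [h β e hβ]
  have h2 : ∀ b : {x // x ∈ B.Pi}, 1 ≤ B.co b θ := by
    intro b
    have h3 := (H.nn _ (B.pi_mem b.2)).co_nonneg b
    rw [map_sub, B.co_simple, if_pos rfl] at h3
    linarith
  have h3 := h1 (-θ) 1 (Or.inr ⟨rfl, rfl⟩)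
  rw [map_neg, B.form_eq_sum] at h3
  have h4 : ∀ b ∈ (Finset.univ : Finset {x // x ∈ B.Pi}), B.co b θ * S.I y (b : V) ≤ 0 :=
    fun b _ => mul_nonpos_of_nonneg_of_nonpos (by linarith [h2 b]) (h1 b 0 (Or.inl ⟨b.2, rfl⟩))
  have h5 := (Finset.sum_eq_zero_iff_of_nonpos h4).mp
    (le_antisymm (Finset.sum_nonpos h4) (by linarith))
  have h6 : S.I y y = 0 := by
    rw [B.form_eq_sum]
    refine Finset.sum_eq_zero fun b hb => ?_
    rw [(mul_eq_zero.mp (h5 b hb)).resolve_left (by linarith [h2 b]), mul_zero]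
  by_contra hne
  exact (S.posdef y hne).ne' h6

/-- A minimal element of the support of an antisymmetric function has trivial finite part. -/
theorem Highest.fst_eq_zero_of_minimal (H : B.Highest θ) {d : V × ℝ → ℝ}
    (hd : B.AffAntisymm θ d)
    (hpair : ∀ y k, d (y, k) ≠ 0 → ∀ α ∈ S.R, ∃ n : ℤ, S.pair α y = n) (φ : V × ℝ → ℝ)
    (hφ : ∀ β e, B.IsSimple θ β e → ∀ y k, 1 < S.pair β y →
      φ (y + (1 - S.pair β y) • β, k + (1 - S.pair β y) * e) < φ (y, k))
    {y : V} {k : ℝ} (hne : d (y, k) ≠ 0) (hmin : ∀ μ, d μ ≠ 0 → φ (y, k) ≤ φ μ) : y = 0 := by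
  refine H.eq_zero_of_dominant fun β e hβ => ?_
  obtain ⟨n, hn⟩ := hpair y k hne β (hβ.mem H)
  have h1 := hd β e hβ y k
  by_contra! hpos
  rcases lt_trichotomy n 1 with h | h | h
  · rw [hn] at hpos
    have : 0 < n := by exact_mod_cast hpos
    omega
  · rw [hn, h] at h1
    simp only [Int.cast_one, sub_self, zero_smul, add_zero, zero_mul] at h1
    exact hne (by linarith)
  · have h2 : 1 < S.pair β y := by rw [hn]; exact_mod_cast h
    refine (hφ β e hβ y k h2).not_ge (hmin _ ?_)
    rw [h1]
    exact neg_ne_zero.mpr hne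

theorem prodCoeff_pair_int {y : V} {k : ℝ} (h : prodCoeff B.affRoot (y, k) ≠ 0) {α : V}
    (hα : α ∈ S.R) : ∃ n : ℤ, S.pair α y = n := by
  obtain ⟨T, hT⟩ := exists_of_prodCoeff_ne_zero h
  have h1 : ∀ j : B.AffIdx, ∃ n : ℤ, S.pair α (B.affRoot j).1 = n := by
    rintro (q | x)
    · exact S.pair_int hα q.2.1
    · exact ⟨0, by simp [affRoot]⟩
  choose f hf using h1
  have h2 := congrArg (S.pair α ∘ₗ LinearMap.fst ℝ V ℝ) hT
  rw [map_sum] at h2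
  simp only [LinearMap.comp_apply, LinearMap.fst_apply, hf] at h2
  exact ⟨∑ j ∈ T, f j, by rw [← h2]; push_cast; rfl⟩

theorem Highest.exists_affHt (H : B.Highest θ) {μ : V × ℝ} (h : prodCoeff B.affRoot μ ≠ 0) :
    ∃ n : ℕ, B.affHt θ μ = n := by
  obtain ⟨T, rfl⟩ := exists_of_prodCoeff_ne_zero h
  have h1 : ∀ j : B.AffIdx, ∃ n : ℤ, B.affHt θ (B.affRoot j) = n := by
    obtain ⟨t, ht⟩ := B.exists_int_ht H.mem
    rintro (q | x)
    · obtain ⟨m, hm⟩ := B.exists_int_ht q.2.1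
      refine ⟨m + (1 + t) * q.1.2, ?_⟩
      simp only [affRoot, Sum.elim_inl, affHt_apply, hm, ht]
      push_cast; ring
    · refine ⟨(1 + t) * (x.1 + 1), ?_⟩
      simp only [affRoot, Sum.elim_inr, affHt_apply, map_zero, ht]
      push_cast; ring
  choose f hf using h1
  have h2 : B.affHt θ (∑ j ∈ T, B.affRoot j) = ((∑ j ∈ T, f j : ℤ) : ℝ) := by
    rw [map_sum]; push_cast; exact Finset.sum_congr rfl fun j _ => hf j
  have h3 := H.graded.sum_nonneg T
  rw [h2] at h3
  obtain ⟨n, hn⟩ := Int.eq_ofNat_of_zero_le (by exact_mod_cast h3 : 0 ≤ ∑ j ∈ T, f j)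
  exact ⟨n, by rw [h2, hn]; simp⟩

/-- The shifted Casimir eigenvalue `|x - ρ|² - |ρ|²`. -/
noncomputable def affQ (B : Base S) (θ : V) (μ : V × ℝ) : ℝ := affForm S μ μ - 2 * B.affRho θ μ

theorem affQ_apply (B : Base S) (θ y : V) (k : ℝ) :
    B.affQ θ (y, k) = S.I y y - 2 * S.I (weylVec B) y - 2 * B.level θ * k := by
  rw [affQ, affForm_apply, affRho_apply]; ring

theorem form_dot (S : RootSys V) {β : V} (hβ : β ∈ S.R) (y : V) :
    S.I (y + (1 - S.pair β y) • β) (y + (1 - S.pair β y) • β) =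
      S.I y y + (1 - S.pair β y) * S.I β β := by
  have h1 := S.pair_mul (S.ne_zero hβ) y
  simp only [map_add, map_smul, LinearMap.add_apply, LinearMap.smul_apply, smul_eq_mul]
  rw [S.symm y β]
  linear_combination (S.pair β y - 1) * h1

theorem Highest.affQ_dot (H : B.Highest θ) {β : V} {e : ℤ} (h : B.IsSimple θ β e) (y : V) (k : ℝ) :
    B.affQ θ (y + (1 - S.pair β y) • β, k + (1 - S.pair β y) * e) = B.affQ θ (y, k) := by
  rw [affQ_apply, affQ_apply, form_dot S (h.mem H), map_add, map_smul, smul_eq_mul, h.norm_eq]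
  ring

theorem Highest.affHt_dot {β : V} {e : ℤ} (h : B.IsSimple θ β e) (y : V) (k : ℝ) :
    B.affHt θ (y + (1 - S.pair β y) • β, k + (1 - S.pair β y) * e) =
      B.affHt θ (y, k) + (1 - S.pair β y) := by
  have h1 := h.affHt_eq
  have h2 : (y + (1 - S.pair β y) • β, k + (1 - S.pair β y) * e) =
      (y, k) + (1 - S.pair β y) • (β, (e : ℝ)) := rfl
  rw [h2, map_add, map_smul, h1, smul_eq_mul, mul_one]

/-- The affine denominator is supported on the zero locus of the shifted Casimir eigenvalue. -/
theorem Highest.affQ_mul_prodCoeff [FiniteDimensional ℝ V] (H : B.Highest θ) (μ : V × ℝ) :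
    B.affQ θ μ * prodCoeff B.affRoot μ = 0 := by
  set d : V × ℝ → ℝ := fun μ => B.affQ θ μ * prodCoeff B.affRoot μ with hd
  have hanti : B.AffAntisymm θ d := by
    intro β e h y k
    simp only [hd]
    rw [H.affQ_dot h, affine_antisymm h H, mul_neg]
  have hlap : ∀ μ, d μ = ∑' x, Graded.laplaceCoeff B.affRoot (affForm S) (B.affRho θ) x *
      prodCoeff B.affRoot (μ - Graded.laplaceVec B.affRoot x) :=
    fun μ => H.graded.laplace_mul_prodCoeff _ _ μ
  by_contra hμ
  have hex : ∃ n : ℕ, ∃ μ, d μ ≠ 0 ∧ B.affHt θ μ = n := by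
    obtain ⟨n, hn⟩ := H.exists_affHt (right_ne_zero_of_mul hμ)
    exact ⟨n, μ, hμ, hn⟩
  obtain ⟨⟨y, k⟩, hne, hn⟩ := Nat.find_spec hex
  have hmin : ∀ μ, d μ ≠ 0 → B.affHt θ (y, k) ≤ B.affHt θ μ := by
    intro μ hμ
    obtain ⟨n, hn'⟩ := H.exists_affHt (right_ne_zero_of_mul hμ)
    rw [hn, hn']
    exact_mod_cast Nat.find_min' hex ⟨μ, hμ, hn'⟩
  have hy := H.fst_eq_zero_of_minimal hanti
    (fun y k h α hα => prodCoeff_pair_int (right_ne_zero_of_mul h) hα) (B.affHt θ)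
    (fun β e h y k h1 => by rw [Highest.affHt_dot h]; linarith) hne hmin
  subst hy
  refine hne ?_
  have hlow := Graded.lowest_coeff H.graded.graded_laplaceVec H.graded _ hlap
    (μ₀ := ((0 : V), k)) fun μ hlt => by
      by_contra hμ
      exact (hmin μ hμ).not_gt hlt
  rw [hlow]
  convert H.degree_sum k

/-- The alternating number of ways to write `x` as `uρ` modulo the lattice `c·Q^∨`. -/
noncomputable def thetaCoeff (B : Base S) (θ : V) (hW : (Weyl S : Set (V ≃ₗ[ℝ] V)).Finite)
    (x : V) : ℝ :=
  ∑ u ∈ hW.toFinset, LinearMap.det ((u : V ≃ₗ[ℝ] V) : V →ₗ[ℝ] V) *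
    if ∃ β ∈ corootLat S, x - u (weylVec B) = B.level θ • β then 1 else 0

theorem thetaCoeff_refl [FiniteDimensional ℝ V] (hW : (Weyl S : Set (V ≃ₗ[ℝ] V)).Finite)
    {α : V} (hα : α ∈ S.R) {β : V} (hβ : β ∈ corootLat S) (x : V) :
    B.thetaCoeff θ hW (S.refl α x + B.level θ • β) = -B.thetaCoeff θ hW x := by
  rw [thetaCoeff, thetaCoeff, ← Finset.sum_neg_distrib]
  have hmem : ∀ u ∈ hW.toFinset, S.refl α * u ∈ hW.toFinset := by
    intro u hu
    rw [Set.Finite.mem_toFinset] at hu ⊢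
    exact mul_mem (S.refl_mem_weyl hα) hu
  have hinv : ∀ u : V ≃ₗ[ℝ] V, S.refl α * (S.refl α * u) = u := by
    intro u; rw [← mul_assoc, S.refl_mul_self, one_mul]
  refine Finset.sum_nbij' (fun u => S.refl α * u) (fun u => S.refl α * u) hmem hmem
    (fun u _ => hinv u) (fun u _ => hinv u) fun u hu => ?_
  have hdet : LinearMap.det ((S.refl α * u : V ≃ₗ[ℝ] V) : V →ₗ[ℝ] V) =
      -LinearMap.det ((u : V ≃ₗ[ℝ] V) : V →ₗ[ℝ] V) := by
    have : ((S.refl α * u : V ≃ₗ[ℝ] V) : V →ₗ[ℝ] V) =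
      (S.refl α : V →ₗ[ℝ] V) ∘ₗ (u : V →ₗ[ℝ] V) := rfl
    rw [this, LinearMap.det_comp, S.det_refl (S.ne_zero hα)]
    ring
  rw [hdet, neg_mul, neg_neg]
  congr 2
  rw [eq_iff_iff]
  have hs := S.refl_mem_weyl hα
  constructor
  · rintro ⟨y, hy, h⟩
    refine ⟨S.refl α (y - β), S.weyl_mem_corootLat hs (sub_mem hy hβ), ?_⟩
    rw [← map_smul, smul_sub, ← h, LinearEquiv.mul_apply, add_sub_right_comm, add_sub_cancel_right,
      map_sub, S.refl_refl]
  · rintro ⟨y, hy, h⟩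
    refine ⟨S.refl α y + β, add_mem (S.weyl_mem_corootLat hs hy) hβ, ?_⟩
    rw [smul_add, ← map_smul, ← h, LinearEquiv.mul_apply, map_sub, S.refl_refl]
    abel

theorem Highest.thetaCoeff_weylVec (H : B.Highest θ)
    (hW : (Weyl S : Set (V ≃ₗ[ℝ] V)).Finite) : B.thetaCoeff θ hW (weylVec B) = 1 := by
  rw [thetaCoeff, Finset.sum_eq_single 1]
  · have h1 : ∃ β ∈ corootLat S,
        weylVec B - (1 : V ≃ₗ[ℝ] V) (weylVec B) = B.level θ • β :=
      ⟨0, zero_mem _, by simp⟩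
    rw [if_pos h1, mul_one]
    exact LinearMap.det_id
  · intro u hu hne
    rw [Set.Finite.mem_toFinset] at hu
    rw [if_neg, mul_zero]
    rintro ⟨β, hβ, h⟩
    exact hne (H.eq_one_of_translate hu hβ h)
  · intro h
    exact absurd (hW.mem_toFinset.mpr (one_mem (Weyl S))) h

theorem weylVec_sub_mem (B : Base S) {u : V ≃ₗ[ℝ] V} (hu : u ∈ Weyl S) {α : V} (hα : α ∈ S.R) :
    ∃ n : ℤ, S.pair α (weylVec B - u (weylVec B)) = n := by
  obtain ⟨L, rfl⟩ := B.exists_word hu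
  have h : weylVec B - B.word L (weylVec B) ∈ AddSubgroup.closure (S.R : Set V) := by
    clear hu
    induction L with
    | nil => simp [word]
    | cons b L ih =>
      have h1 : weylVec B - B.word (b :: L) (weylVec B) =
          b + S.refl (b : V) (weylVec B - B.word L (weylVec B)) := by
        rw [word_cons, LinearEquiv.mul_apply, map_sub, B.refl_weylVec b.2]; abel
      rw [h1]
      refine add_mem (AddSubgroup.subset_closure (B.pi_mem b.2)) ?_
      generalize weylVec B - B.word L (weylVec B) = z at ih
      induction ih using AddSubgroup.closure_induction with
      | mem z hz => exact AddSubgroup.subset_closure (S.refl_mem (B.pi_mem b.2) hz)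
      | zero => simp
      | add z w _ _ hz hw => rw [map_add]; exact add_mem hz hw
      | neg z _ hz => rw [map_neg]; exact neg_mem hz
  generalize weylVec B - B.word L (weylVec B) = z at h
  induction h using AddSubgroup.closure_induction with
  | mem z hz => exact S.pair_int hα hz
  | zero => exact ⟨0, by simp⟩
  | add x y _ _ hx hy =>
    obtain ⟨n, hn⟩ := hx
    obtain ⟨m, hm⟩ := hy
    exact ⟨n + m, by rw [map_add, hn, hm]; push_cast; ring⟩
  | neg x _ hx =>
    obtain ⟨n, hn⟩ := hx
    exact ⟨-n, by rw [map_neg, hn]; push_cast; ring⟩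

theorem Highest.thetaCoeff_pair_int (H : B.Highest θ) (hW : (Weyl S : Set (V ≃ₗ[ℝ] V)).Finite)
    {y : V} (h : B.thetaCoeff θ hW (weylVec B - y) ≠ 0) {α : V} (hα : α ∈ S.R) :
    ∃ n : ℤ, S.pair α y = n := by
  obtain ⟨u, hu, hne⟩ := Finset.exists_ne_zero_of_sum_ne_zero h
  rw [Set.Finite.mem_toFinset] at hu
  obtain ⟨β, hβ, hx⟩ : ∃ β ∈ corootLat S,
      weylVec B - y - u (weylVec B) = B.level θ • β := by
    by_contra h1
    rw [if_neg h1, mul_zero] at hne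
    exact hne rfl
  have h2 : y = weylVec B - u (weylVec B) - B.level θ • β := by rw [← hx]; abel
  obtain ⟨n, hn⟩ := B.weylVec_sub_mem hu hα
  obtain ⟨m, hm⟩ := H.level_mul_pair_int hβ hα
  exact ⟨n - m, by rw [h2, map_sub, hn, hm]; push_cast; rfl⟩

theorem IsSimple.translation_mem {β : V} {e : ℤ} (h : B.IsSimple θ β e) (H : B.Highest θ) :
    ∃ γ ∈ corootLat S, (S.pair β (weylVec B) - 1) • β = B.level θ • γ := by
  rcases h with ⟨h, -⟩ | ⟨rfl, -⟩
  · exact ⟨0, zero_mem _, by rw [B.pair_weylVec h]; simp⟩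
  · refine ⟨_, S.coroot_mem H.mem, ?_⟩
    have hN := (S.form_pos H.mem).ne'
    rw [smul_neg, ← neg_smul, smul_smul, level, S.pair_apply]
    congr 1
    simp only [map_neg, LinearMap.neg_apply, neg_neg]
    rw [S.symm θ (weylVec B)]
    field_simp
    ring

theorem Highest.prodCoeff_eq_theta [FiniteDimensional ℝ V] (H : B.Highest θ)
    (hW : (Weyl S : Set (V ≃ₗ[ℝ] V)).Finite) (y : V) (k : ℝ) :
    prodCoeff B.affRoot (y, k) =
      if B.affQ θ (y, k) = 0 then B.thetaCoeff θ hW (weylVec B - y) else 0 := by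
  set b : V × ℝ → ℝ := fun μ =>
    if B.affQ θ μ = 0 then B.thetaCoeff θ hW (weylVec B - μ.1) else 0 with hb
  set d : V × ℝ → ℝ := fun μ => prodCoeff B.affRoot μ - b μ with hd
  have hanti : B.AffAntisymm θ d := by
    intro β e h y k
    have hβ := h.mem H
    obtain ⟨γ, hγ, hγβ⟩ := h.translation_mem H
    have h1 : weylVec B - (y + (1 - S.pair β y) • β) =
        S.refl β (weylVec B - y) + B.level θ • γ := by
      rw [← hγβ, S.refl_apply, map_sub]; module
    simp only [hd, hb]
    rw [affine_antisymm h H, H.affQ_dot h, h1, thetaCoeff_refl hW hβ hγ]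
    split_ifs <;> ring
  have hQ : ∀ μ, d μ ≠ 0 → B.affQ θ μ = 0 := by
    intro μ hμ
    by_contra hne
    have h1 := (mul_eq_zero.mp (H.affQ_mul_prodCoeff μ)).resolve_left hne
    exact hμ (by simp [hd, hb, h1, hne])
  have hpair : ∀ y k, d (y, k) ≠ 0 → ∀ α ∈ S.R, ∃ n : ℤ, S.pair α y = n := by
    intro y k h α hα
    by_cases h1 : prodCoeff B.affRoot (y, k) = 0
    · refine H.thetaCoeff_pair_int hW (y := y) (fun h2 => h ?_) hα
      simp [hd, hb, h1, h2]
    · exact prodCoeff_pair_int h1 hα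
  rw [← sub_eq_zero]
  change d (y, k) = 0
  by_contra hne
  obtain ⟨y₀, ⟨⟨k₀, hne₀⟩, hle⟩, hmin⟩ := Set.exists_min_image
    {z : V | (∃ k, d (z, k) ≠ 0) ∧ S.I z z ≤ S.I y y} (fun z => S.I z z)
    ((B.finite_lattice (S.I y y)).subset fun z ⟨⟨k, hk⟩, hz⟩ => ⟨hpair z k hk, hz⟩)
    ⟨y, ⟨k, hne⟩, le_rfl⟩
  have h0 := H.fst_eq_zero_of_minimal hanti hpair (fun μ => S.I μ.1 μ.1)
    (fun β e h z m h1 => by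
      simp only [form_dot S (h.mem H)]
      have := S.form_pos (h.mem H)
      nlinarith) hne₀ (by
      rintro ⟨z, m⟩ hz
      by_cases hzy : S.I z z ≤ S.I y y
      · exact hmin z ⟨⟨m, hz⟩, hzy⟩
      · exact hle.trans (not_le.mp hzy).le)
  subst h0
  have h1 := hQ _ hne₀
  rw [affQ_apply] at h1
  have hc := H.level_pos
  have hk : k₀ = 0 := by
    simp only [map_zero, mul_zero, sub_zero, zero_sub, neg_eq_zero] at h1
    rcases mul_eq_zero.mp h1 with h2 | h2
    · linarith
    · exact h2
  subst hk
  refine hne₀ ?_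
  simp only [hd, hb, sub_zero]
  rw [if_pos (by rw [affQ_apply]; simp), H.thetaCoeff_weylVec]
  have : ((0, 0) : V × ℝ) = 0 := rfl
  rw [this, H.graded.prodCoeff_zero, sub_self]

end Base

theorem Graded.comp_injective {J J' M : Type*} [AddCommGroup M] [Module ℝ M] {h : M →ₗ[ℝ] ℝ}
    {v : J → M} (hv : Graded h v) {f : J' → J} (hf : Function.Injective f) :
    Graded h (v ∘ f) :=
  ⟨fun _ => hv.one_le _, fun N => (hv.finite N).preimage hf.injOn⟩

namespace Base

variable {V : Type} [AddCommGroup V] [Module ℝ V] {S : RootSys V} {B : Base S} {θ : V}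

/-- Multiplication by the Weyl denominator `∏_{α > 0} (1 - e^{-α})` is injective on functions
with support of bounded height. -/
theorem eq_zero_of_denominator_mul {F : V → ℝ} {N : ℝ} (hN : ∀ x, F x ≠ 0 → B.ht x ≤ N)
    (hF : ∀ x, ∑ T ∈ B.Pos.powerset, (-1 : ℝ) ^ T.card * F (x + ∑ α ∈ T, α) = 0) (x : V) :
    F x = 0 := by
  have main : ∀ n : ℕ, ∀ x, N - n < B.ht x → F x = 0 := by
    intro n
    induction n with
    | zero =>
      intro x hx
      by_contra h
      have := hN x h
      simp at hx
      linarith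
    | succ n ih =>
      intro x hx
      have h := hF x
      rw [Finset.sum_eq_single ∅ (fun T hT hne => ?_) (by simp)] at h
      · simpa using h
      · rw [ih, mul_zero]
        have h1 : (1 : ℝ) ≤ ∑ α ∈ T, B.ht α := by
          obtain ⟨α, hα⟩ := Finset.nonempty_iff_ne_empty.mpr hne
          have hpos : ∀ β ∈ T, 1 ≤ B.ht β := fun β hβ =>
            B.one_le_ht (Finset.mem_powerset.mp hT hβ)
          exact (hpos α hα).trans (Finset.single_le_sum
            (fun β hβ => zero_le_one.trans (hpos β hβ)) hα)
        rw [map_add, map_sum]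
        push_cast at hx
        linarith
  obtain ⟨n, hn⟩ := exists_nat_gt (N - B.ht x)
  exact main n x (by linarith)

theorem exists_ht_le_of_memE {f : HatV V → ℝ} (hf : memE B (deltaH - embH θ) f) (m n : ℝ) :
    ∃ N, ∀ x, f (x, m, n) ≠ 0 → B.ht x ≤ N := by
  obtain ⟨r, μ, hμ⟩ := hf
  refine ⟨∑ i, |B.ht (μ i).1 + ((μ i).2.1 - m) * B.ht θ|, fun x hx => ?_⟩
  obtain ⟨i, k, cf, h⟩ := hμ _ hx
  have hk : m = (μ i).2.1 - k := by
    simpa [deltaH, embH] using congrArg (fun p : HatV V => p.2.1) h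
  have hx' : x = (μ i).1 + (k : ℝ) • θ - ∑ b ∈ B.Pi, (cf b : ℝ) • b := by
    simpa [deltaH, embH] using congrArg (fun p : HatV V => p.1) h
  obtain ⟨j, hj⟩ := Nn.exists_ht (B := B) ⟨cf, rfl⟩
  have hj0 : (0 : ℝ) ≤ j := j.cast_nonneg
  have h1 : B.ht x ≤ B.ht (μ i).1 + ((μ i).2.1 - m) * B.ht θ := by
    rw [hx', map_sub, map_add, map_smul, smul_eq_mul, hj, hk]
    linarith
  exact h1.trans ((le_abs_self _).trans (Finset.single_le_sum
    (f := fun i => |B.ht (μ i).1 + ((μ i).2.1 - m) * B.ht θ|)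
    (fun _ _ => abs_nonneg _) (Finset.mem_univ i)))

variable (S) in
/-- Indices of the positive affine roots that are not finite roots. -/
abbrev LoopIdx : Type := (ℕ × Fin (Module.finrank ℝ V)) ⊕ (ℕ × {α : V // α ∈ S.R})

variable (S) in
/-- The positive affine root with a given index. -/
def loopRoot : LoopIdx S → V × ℝ :=
  Sum.elim (fun x => (0, (x.1 : ℝ) + 1)) fun x => (x.2.1, (x.1 : ℝ) + 1)

variable (B) in
/-- The positive affine roots are the positive finite ones and those of positive level. -/
def affIdxOfSum : {α : V // α ∈ B.Pos} ⊕ LoopIdx S → B.AffIdx :=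
  Sum.elim (fun α => Sum.inl ⟨(α.1, 0), B.pos_sub α.2, Or.inr ⟨rfl, α.2⟩⟩)
    (Sum.elim Sum.inr fun x =>
      Sum.inl ⟨(x.2.1, (x.1 : ℤ) + 1), x.2.2, Or.inl (by positivity)⟩)

theorem affIdxOfSum_bijective : Function.Bijective B.affIdxOfSum := by
  constructor
  · rintro (α | x | ⟨n, α⟩) (β | y | ⟨m, β⟩) h <;>
      simp only [affIdxOfSum, Sum.elim_inl, Sum.elim_inr, Sum.inl.injEq, Sum.inr.injEq,
        Subtype.mk.injEq, Prod.mk.injEq, reduceCtorEq] at h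
    · exact congrArg _ (Subtype.ext h.1)
    · omega
    · exact congrArg _ (congrArg _ h)
    · omega
    · obtain ⟨h1, h2⟩ := h
      have h3 : n = m := by omega
      rw [h3, Subtype.ext h1]
  · rintro (⟨⟨α, n⟩, hα, hn⟩ | x)
    · simp only at hα hn
      rcases hn with hn | ⟨rfl, hn⟩
      · obtain ⟨k, rfl⟩ : ∃ k : ℕ, n = k + 1 := ⟨(n - 1).toNat, by omega⟩
        exact ⟨Sum.inr (Sum.inr (k, ⟨α, hα⟩)), rfl⟩
      · exact ⟨Sum.inl ⟨α, hn⟩, rfl⟩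
    · exact ⟨Sum.inr (Sum.inl x), rfl⟩

theorem affRoot_comp_affIdxOfSum : B.affRoot ∘ B.affIdxOfSum =
    Sum.elim (fun α : {α : V // α ∈ B.Pos} => ((α : V), (0 : ℝ))) (loopRoot S) := by
  funext i
  rcases i with α | x | x <;> simp [affRoot, affIdxOfSum, loopRoot]

theorem Highest.graded_elim (H : B.Highest θ) : Graded (B.affHt θ)
    (Sum.elim (fun α : {α : V // α ∈ B.Pos} => ((α : V), (0 : ℝ))) (loopRoot S)) :=
  affRoot_comp_affIdxOfSum (B := B) ▸ H.graded.comp_injective affIdxOfSum_bijective.1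

theorem Highest.graded_loopRoot (H : B.Highest θ) : Graded (B.affHt θ) (loopRoot S) :=
  H.graded_elim.comp_injective Sum.inr_injective

/-- Splitting the affine denominator into the finite denominator and the factors of positive
level. -/
theorem Highest.prodCoeff_affRoot_eq_sum (H : B.Highest θ) (y : V) (k : ℝ) :
    prodCoeff B.affRoot (y, k) =
      ∑ T ∈ B.Pos.powerset, (-1 : ℝ) ^ T.card * prodCoeff (loopRoot S) (y - ∑ α ∈ T, α, k) := by
  have h := prodCoeff_comp_equiv (Equiv.ofBijective _ affIdxOfSum_bijective) B.affRoot (y, k)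
  rw [Equiv.coe_ofBijective, affRoot_comp_affIdxOfSum] at h
  rw [← h, prodCoeff_sumElim Finset.univ (fun _ => Finset.mem_univ _) H.graded_elim]
  refine Finset.sum_nbij' (fun T => T.map (Function.Embedding.subtype _))
    (fun T => T.subtype (· ∈ B.Pos)) ?_ (fun _ _ => Finset.mem_univ _) ?_ ?_ ?_
  · intro T _
    rw [Finset.mem_powerset]
    intro x hx
    obtain ⟨a, -, rfl⟩ := Finset.mem_map.mp hx
    exact a.2
  · intro T _
    ext x
    simp
  · intro T hT
    exact Finset.subtype_map_of_mem fun x hx => Finset.mem_powerset.mp hT hx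
  · intro T _
    rw [Finset.card_map, Finset.sum_map]
    congr 2
    ext <;> simp [Prod.fst_sum, Prod.snd_sum]

theorem Highest.exists_ht_le_of_prodCoeff (H : B.Highest θ) {y : V} {k : ℝ}
    (h : prodCoeff (loopRoot S) (y, k) ≠ 0) : -B.ht y ≤ (1 + B.ht θ) * k := by
  by_contra! h1
  refine h (H.graded_loopRoot.prodCoeff_eq_zero ?_)
  rw [affHt_apply]
  linarith

/-- The coefficients of a numerator-over-denominator quotient of finite type vanish off `F_f`. -/
theorem eq_zero_of_ne_embH {f : HatV V → ℝ} {ρ : V} {g : HatV V → ℝ}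
    (hf : memE B (deltaH - embH θ) f)
    (hfg : ∀ p, ∑ T ∈ B.Pos.powerset, (-1 : ℝ) ^ T.card *
      f (p - embH ρ + embH (∑ α ∈ T, α)) = g p)
    (hg : ∀ p, p.2 ≠ 0 → g p = 0) {p : HatV V} (hp : p.2 ≠ 0) : f p = 0 := by
  obtain ⟨x, m, n⟩ := p
  obtain ⟨N, hN⟩ := exists_ht_le_of_memE hf m n
  refine eq_zero_of_denominator_mul (B := B) (F := fun x => f (x, m, n)) hN (fun x => ?_) x
  have h := hfg (x + ρ, m, n)
  rw [hg (x + ρ, m, n) hp] at h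
  simpa [embH] using h

theorem Highest.finite_norm_eq [FiniteDimensional ℝ V] (H : B.Highest θ) (N : ℝ) :
    {γ : {x : V // ∃ y ∈ corootLat S, x = B.level θ • y} |
      S.I (weylVec B + γ) (weylVec B + γ) = N}.Finite := by
  refine Set.Finite.preimage Subtype.val_injective.injOn
    (s := {γ : V | (∃ y ∈ corootLat S, γ = B.level θ • y) ∧
      S.I (weylVec B + γ) (weylVec B + γ) = N}) ?_ |>.subset fun γ hγ => ⟨γ.2, hγ⟩
  refine (B.finite_lattice (2 * N + 2 * S.I (weylVec B) (weylVec B))).subset ?_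
  rintro _ ⟨⟨y, hy, rfl⟩, hN⟩
  refine ⟨fun α hα => H.level_mul_pair_int hy hα, ?_⟩
  set γ := B.level θ • y
  have h := S.form_self_nonneg ((2 : ℝ) • weylVec B + γ)
  simp only [map_add, map_smul, LinearMap.add_apply, LinearMap.smul_apply, smul_eq_mul,
    S.symm γ (weylVec B)] at h hN
  linarith

theorem exists_sub_weyl_iff {u : V ≃ₗ[ℝ] V} (hu : u ∈ Weyl S) (x ρ : V) (c : ℝ) :
    (∃ β ∈ corootLat S, x - u ρ = c • β) ↔ ∃ β ∈ corootLat S, u.symm x - ρ = c • β := by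
  constructor
  · rintro ⟨β, hβ, h⟩
    refine ⟨u.symm β, ?_, ?_⟩
    · rw [← S.weyl_mem_corootLat_iff hu, u.apply_symm_apply]; exact hβ
    · rw [← map_smul, ← h, map_sub, u.symm_apply_apply]
  · rintro ⟨β, hβ, h⟩
    refine ⟨u β, (S.weyl_mem_corootLat_iff hu).mpr hβ, ?_⟩
    rw [← map_smul, ← h, map_sub, u.apply_symm_apply]

/-- The theta function as a sum of alternating orbit sums. -/
theorem sum_alternating_eq_thetaCoeff (hW : (Weyl S : Set (V ≃ₗ[ℝ] V)).Finite) (N : ℝ)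
    (Γ : Finset {x : V // ∃ y ∈ corootLat S, x = B.level θ • y})
    (hΓ : ∀ γ, γ ∈ Γ ↔ S.I (weylVec B + γ) (weylVec B + γ) = N) (x : V) :
    (∑ γ ∈ Γ, ∑ u ∈ hW.toFinset, LinearMap.det ((u : V ≃ₗ[ℝ] V) : V →ₗ[ℝ] V) *
        if x = u (weylVec B + γ) then 1 else 0) =
      if S.I x x = N then B.thetaCoeff θ hW x else 0 := by
  have key : ∀ u ∈ hW.toFinset, (∑ γ ∈ Γ, if x = u (weylVec B + γ) then (1 : ℝ) else 0) =
      if S.I x x = N ∧ ∃ β ∈ corootLat S, x - u (weylVec B) = B.level θ • β then 1 else 0 := by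
    intro u hu
    rw [Set.Finite.mem_toFinset] at hu
    split_ifs with h
    · obtain ⟨hx, h⟩ := h
      rw [exists_sub_weyl_iff hu] at h
      rw [Finset.sum_eq_single_of_mem ⟨u.symm x - weylVec B, h⟩, if_pos (by simp)]
      · rw [hΓ, ← S.form_weyl hu]
        simpa using hx
      · intro γ _ hγ
        rw [if_neg]
        rintro rfl
        exact hγ (Subtype.ext (by simp))
    · refine Finset.sum_eq_zero fun γ hγ => if_neg ?_
      rintro rfl
      refine h ⟨by rw [S.form_weyl hu]; exact (hΓ γ).mp hγ, ?_⟩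
      rw [exists_sub_weyl_iff hu]
      simpa using γ.2
  rw [Finset.sum_comm]
  simp_rw [← Finset.mul_sum]
  rw [Finset.sum_congr rfl fun u hu => by rw [key u hu]]
  split_ifs with h
  · simp [thetaCoeff, h]
  · simp [h]

end Base

namespace Base

variable {V : Type} [AddCommGroup V] [Module ℝ V] {S : RootSys V} {B : Base S} {θ : V}

theorem level_eq (S : RootSys V) (B : Base S) {θ : V} (hθ : θ ∈ S.R) :
    S.I θ θ / 2 * (1 + S.I (weylVec B) ((2 / S.I θ θ) • θ)) = B.level θ := by
  have h := (S.form_pos hθ).ne'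
  rw [level, map_smul, smul_eq_mul]
  field_simp

/-- The product over the affine roots of positive level, as a coefficient function on `F̂`. -/
theorem tsum_finset_eq_prodCoeff (K : ℝ) (p : HatV V) :
    (∑' T : {T : Finset (LoopIdx S) // p = K • deltaH - ∑ i ∈ T,
        (Sum.elim (fun x => ((x.1 : ℝ) + 1) • deltaH)
          (fun x => embH x.2.1 + ((x.1 : ℝ) + 1) • deltaH) : LoopIdx S → HatV V) i},
      (-1 : ℝ) ^ T.1.card) =
    if p.2.2 = 0 then prodCoeff (loopRoot S) (-p.1, K - p.2.1) else 0 := by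
  have hvec : (Sum.elim (fun x => ((x.1 : ℝ) + 1) • deltaH)
      (fun x => embH x.2.1 + ((x.1 : ℝ) + 1) • deltaH) : LoopIdx S → HatV V) =
      fun i => ((loopRoot S i).1, (loopRoot S i).2, 0) := by
    funext i
    rcases i with x | x <;> simp [loopRoot, deltaH, embH]
  have hiff : ∀ T : Finset (LoopIdx S),
      p = K • deltaH - ∑ i ∈ T, ((loopRoot S i).1, (loopRoot S i).2, (0 : ℝ)) ↔
        p.2.2 = 0 ∧ ∑ i ∈ T, loopRoot S i = (-p.1, K - p.2.1) := by
    intro T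
    rw [Prod.ext_iff, Prod.ext_iff, Prod.ext_iff]
    simp only [deltaH, Prod.fst_sub, Prod.snd_sub, Prod.smul_fst, Prod.smul_snd, Prod.fst_sum,
      Prod.snd_sum, Finset.sum_const_zero, smul_zero, smul_eq_mul, mul_one, zero_sub]
    constructor
    · rintro ⟨h1, h2, h3⟩
      exact ⟨by simpa using h3, by rw [h1, neg_neg], by rw [h2]; ring⟩
    · rintro ⟨h3, h1, h2⟩
      exact ⟨by rw [h1, neg_neg], by rw [h2]; ring, by simpa using h3⟩
  rw [hvec]
  refine (tsum_subtype {T : Finset (LoopIdx S) |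
    p = K • deltaH - ∑ i ∈ T, ((loopRoot S i).1, (loopRoot S i).2, (0 : ℝ))}
    fun T => (-1 : ℝ) ^ T.card).trans ?_
  split_ifs with h
  · refine tsum_congr fun T => ?_
    rw [Set.indicator_apply]
    have := (hiff T).trans (and_iff_right h)
    simp only [Set.mem_ofPred_eq, this]
    congr
  · refine (tsum_congr fun T => ?_).trans tsum_zero
    exact (Set.indicator_apply _ _ _).trans (if_neg fun hT => h ((hiff T).mp hT).1)

end Base

/-- **Intermediate identity (7), untwisted case** (coefficientwise, in the algebra `ℰ`):
`e^{−(I(ρ_f,ρ_f)/2c)δ} ∏_{n≥1} ((1−e^{−nδ})^l ∏_{α∈R_f} (1−e^{−α−nδ}))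
 = Σ_{γ ∈ c·Q(R_f^∨)} A_γ e^{−(I(ρ_f+γ,ρ_f+γ)/2c)δ}`,
where `A_γ` is the unique element of `ℰ` with
`A_γ · (e^{ρ_f} ∏_{α∈R_f⁺} (1−e^{−α})) = Σ_{u∈W(R_f)} det(u) e^{u(ρ_f+γ)}`. -/
theorem intermediate_identity_untwisted (V : Type) [AddCommGroup V] [Module ℝ V]
    [FiniteDimensional ℝ V]
    (S : RootSys V) (B : Base S)
    -- θ is the highest root
    (θ : V) (hθR : θ ∈ S.R)
    (hθhigh : ∀ α ∈ S.R, ∃ cf : V → ℕ, θ - α = ∑ b ∈ B.Pi, (cf b : ℝ) • b)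
    -- h^∨ = 1 + I(ρ_f,θ^∨) and c = (I(θ,θ)/2)·h^∨
    (hv : ℝ) (hhv : hv = 1 + S.I (weylVec B) ((2 / S.I θ θ) • θ))
    (c : ℝ) (hc : c = S.I θ θ / 2 * hv)
    -- the Weyl group is finite
    (hWfin : (Weyl S : Set (V ≃ₗ[ℝ] V)).Finite)
    -- the coefficient functions A_γ of the elements A_γ ∈ ℰ
    (A : V → HatV V → ℝ)
    (hAE : ∀ γ : V, (∃ y ∈ corootLat S, γ = c • y) → memE B (deltaH - embH θ) (A γ))
    -- A_γ · (e^{ρ_f} ∏_{α ∈ R_f⁺} (1 − e^{−α})) = Σ_{u ∈ W(R_f)} det(u)·e^{u(ρ_f+γ)}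
    (hA : ∀ γ : V, (∃ y ∈ corootLat S, γ = c • y) → ∀ p : HatV V,
      ∑ T ∈ B.Pos.powerset, (-1 : ℝ) ^ T.card *
          A γ (p - embH (weylVec B) + embH (∑ α ∈ T, α)) =
        ∑ u ∈ hWfin.toFinset, LinearMap.det ((u : V ≃ₗ[ℝ] V) : V →ₗ[ℝ] V) *
          (if p = embH (u (weylVec B + γ)) then 1 else 0)) :
    -- the factors of the infinite product: (1−e^{−nδ}) with multiplicity l = rk R_f,
    -- and (1−e^{−α−nδ}) for α ∈ R_f, n ≥ 1
    let vec : (ℕ × Fin (Module.finrank ℝ V)) ⊕ (ℕ × {α : V // α ∈ S.R}) → HatV V :=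
      Sum.elim (fun x => ((x.1 : ℝ) + 1) • deltaH)
        (fun x => embH x.2.1 + ((x.1 : ℝ) + 1) • deltaH)
    -- coefficientwise identity of the two sides
    ∀ p : HatV V,
      (∑' T : {T : Finset ((ℕ × Fin (Module.finrank ℝ V)) ⊕ (ℕ × {α : V // α ∈ S.R})) //
          p = (-(S.I (weylVec B) (weylVec B) / (2 * c))) • deltaH - ∑ i ∈ T, vec i},
        (-1 : ℝ) ^ T.1.card) =
      ∑' γ : {x : V // ∃ y ∈ corootLat S, x = c • y},
        A γ.1 (p + (S.I (weylVec B + γ.1) (weylVec B + γ.1) / (2 * c)) • deltaH) := by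
  intro vec p
  have H : B.Highest θ := ⟨hθR, hθhigh⟩
  obtain rfl : c = B.level θ := by rw [hc, hhv, B.level_eq S hθR]
  have hc0 := H.level_pos
  refine (Base.tsum_finset_eq_prodCoeff _ p).trans ?_
  have hoff : ∀ γ : {x : V // ∃ y ∈ corootLat S, x = B.level θ • y}, ∀ q : HatV V,
      q.2 ≠ 0 → A γ.1 q = 0 := by
    intro γ q hq
    refine Base.eq_zero_of_ne_embH (hAE _ γ.2) (hA _ γ.2) (fun q hq => ?_) hq
    refine Finset.sum_eq_zero fun u _ => ?_
    rw [if_neg, mul_zero]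
    rintro rfl
    exact hq rfl
  obtain ⟨x, m, n⟩ := p
  split_ifs with hn
  swap
  · refine ((tsum_congr fun γ => hoff γ _ fun h => hn ?_).trans tsum_zero).symm
    simpa [deltaH] using congrArg Prod.snd h
  obtain rfl : n = 0 := hn
  set ρ := weylVec B with hρ
  set N := -(2 * B.level θ * m) with hN
  set Γ := (H.finite_norm_eq N).toFinset with hΓ
  have hΓmem : ∀ γ, γ ∈ Γ ↔ S.I (ρ + γ) (ρ + γ) = N := fun γ => by simp [hΓ, hρ]
  have hdeg : ∀ γ : V, m + S.I (ρ + γ) (ρ + γ) / (2 * B.level θ) = 0 ↔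
      S.I (ρ + γ) (ρ + γ) = N := by
    intro γ
    field_simp
    rw [hN]
    constructor <;> intro h <;> linarith
  have hR : ∀ x, (∑' γ : {x : V // ∃ y ∈ corootLat S, x = B.level θ • y},
      A γ.1 ((x, m, 0) + (S.I (ρ + γ.1) (ρ + γ.1) / (2 * B.level θ)) • deltaH)) =
      ∑ γ ∈ Γ, A γ.1 (x, 0, 0) := by
    intro x
    rw [tsum_eq_sum (s := Γ)]
    · refine Finset.sum_congr rfl fun γ hγ => ?_
      have := (hdeg γ).mpr ((hΓmem γ).mp hγ)
      congr 1
      ext <;> simp only [deltaH, Prod.fst_add, Prod.snd_add, Prod.smul_fst, Prod.smul_snd,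
        smul_zero, add_zero, smul_eq_mul, mul_one, mul_zero, this]
    · intro γ hγ
      refine hoff γ _ fun h => hγ ((hΓmem γ).mpr ((hdeg γ).mp ?_))
      simpa [deltaH] using congrArg Prod.fst h
  rw [hR, ← sub_eq_zero]
  choose M hM using fun γ : {x : V // ∃ y ∈ corootLat S, x = B.level θ • y} =>
    Base.exists_ht_le_of_memE (hAE _ γ.2) 0 0
  set K := -(S.I ρ ρ / (2 * B.level θ)) with hK
  refine Base.eq_zero_of_denominator_mul (B := B)
    (F := fun x => prodCoeff (Base.loopRoot S) (-x, K - m) - ∑ γ ∈ Γ, A γ.1 (x, 0, 0))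
    (N := |(1 + B.ht θ) * (K - m)| + ∑ γ ∈ Γ, |M γ|) (fun x hx => ?_) (fun x => ?_) x
  · have hsum : 0 ≤ ∑ γ ∈ Γ, |M γ| := Finset.sum_nonneg fun _ _ => abs_nonneg _
    have habs := le_abs_self ((1 + B.ht θ) * (K - m))
    by_cases h : prodCoeff (Base.loopRoot S) (-x, K - m) = 0
    · obtain ⟨γ, hγ, hne⟩ := Finset.exists_ne_zero_of_sum_ne_zero (s := Γ)
        (f := fun γ => A γ.1 (x, 0, 0)) fun h0 => hx (by simp only [h, h0, sub_zero])
      have h1 := (hM γ x hne).trans ((le_abs_self _).trans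
        (Finset.single_le_sum (f := fun γ => |M γ|) (fun _ _ => abs_nonneg _) hγ))
      have := abs_nonneg ((1 + B.ht θ) * (K - m))
      linarith
    · have h1 := H.exists_ht_le_of_prodCoeff h
      rw [map_neg, neg_neg] at h1
      linarith
  · have h1 := H.prodCoeff_affRoot_eq_sum (-x) (K - m)
    rw [H.prodCoeff_eq_theta hWfin] at h1
    have h2 := Base.sum_alternating_eq_thetaCoeff hWfin N Γ hΓmem (x + ρ)
    have h3 : ∀ γ : {x : V // ∃ y ∈ corootLat S, x = B.level θ • y},
        ∑ T ∈ B.Pos.powerset, (-1 : ℝ) ^ T.card * A γ.1 (x + ∑ α ∈ T, α, 0, 0) =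
        ∑ u ∈ hWfin.toFinset, LinearMap.det ((u : V ≃ₗ[ℝ] V) : V →ₗ[ℝ] V) *
          if x + ρ = u (ρ + γ) then 1 else 0 := by
      intro γ
      have h := hA γ.1 γ.2 (embH (x + ρ))
      simpa [embH] using h
    have h4 : B.affQ θ (-x, K - m) = 0 ↔ S.I (x + ρ) (x + ρ) = N := by
      have hKc : 2 * B.level θ * K = -S.I ρ ρ := by rw [hK]; field_simp
      rw [Base.affQ_apply, mul_sub, hKc, hN]
      simp only [map_neg, map_add, LinearMap.neg_apply, LinearMap.add_apply, S.symm x]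
      constructor <;> intro h <;> linarith
    simp only [mul_sub, Finset.sum_sub_distrib, Finset.mul_sum]
    rw [Finset.sum_comm (s := B.Pos.powerset)]
    rw [Finset.sum_congr rfl fun γ _ => h3 γ, h2, sub_eq_zero]
    simp_rw [neg_add, ← sub_eq_add_neg, ← h1]
    rw [sub_neg_eq_add, add_comm (weylVec B)]
    exact if_congr h4 rfl rfl
end
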